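/- arXiv:2502.03694 — 8 statements merged into one kernel-verified Lean document; each statement's English description precedes it below -/
import Mathlib

section
/- Let G be a real symmetric n×n matrix with eigenvalues λ₁ ≤ λ₂ ≤ … ≤ λₙ listed in nondecreasing order with multiplicity, and let 1 ≤ k ≤ n−1 with λ_k < λ_{k+1}. Then the function f(R) = ‖R − G‖_F², restricted to the set 𝓡_k = {R ∈ Sym_n : R² = I, dim ker(R + I) = k} (with the topology induced by the Frobenius norm), has exactly one local minimum point, namely R* = I − 2P, where P is the orthogonal projection onto the sum of the eigenspaces of G corresponding to the k smallest eigenvalues λ₁, …, λ_k. -/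
open Matrix

/-- The reflection manifold `𝓡_k = {R ∈ Sym_n : R² = I, dim ker(R + I) = k}`. -/
def reflectionManifold (n k : ℕ) : Set (Matrix (Fin n) (Fin n) ℝ) :=
  {R | R.IsSymm ∧ R * R = 1 ∧
    Module.finrank ℝ (LinearMap.ker (R + 1).mulVecLin) = k}

/-- The squared Frobenius distance `f(R) = ‖R − G‖_F² = trace((R − G)ᵀ(R − G))`. -/
def frobDistSq {n : ℕ} (G R : Matrix (Fin n) (Fin n) ℝ) : ℝ :=
  Matrix.trace ((R - G)ᵀ * (R - G))

section Helpers

lemma aux_sd {n : ℕ} {R : Matrix (Fin n) (Fin n) ℝ} (hR : R.IsSymm) (a b : Fin n → ℝ) :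
    (R *ᵥ a) ⬝ᵥ b = a ⬝ᵥ (R *ᵥ b) := by
  rw [dotProduct_mulVec, ← mulVec_transpose, hR.eq]

lemma aux_finrank {n : ℕ} {R : Matrix (Fin n) (Fin n) ℝ} (hR : R * R = 1) :
    (Module.finrank ℝ (LinearMap.ker (R + 1).mulVecLin) : ℝ) = ((n : ℝ) - R.trace) / 2 := by
  have hp : LinearMap.IsProj (LinearMap.ker (R + 1).mulVecLin)
      (Matrix.toLin' ((1 / 2 : ℝ) • (1 - R))) := by
    constructor
    · intro x
      simp only [LinearMap.mem_ker, Matrix.mulVecLin_apply, Matrix.toLin'_apply,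
        Matrix.mulVec_mulVec]
      have : (R + 1) * ((1 / 2 : ℝ) • (1 - R)) = 0 := by
        rw [mul_smul_comm, add_mul, mul_sub, hR]
        simp
      rw [this, zero_mulVec]
    · intro x hx
      simp only [LinearMap.mem_ker, Matrix.mulVecLin_apply, add_mulVec, one_mulVec] at hx
      have h2 : R *ᵥ x = -x := eq_neg_of_add_eq_zero_left hx
      simp only [Matrix.toLin'_apply, smul_mulVec, sub_mulVec, one_mulVec, h2]
      module
  have := hp.trace
  rw [Matrix.trace_toLin'_eq] at this
  rw [← this]
  simp [Matrix.trace_sub, Matrix.trace_smul]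
  ring

lemma aux_mem {n k : ℕ} {R : Matrix (Fin n) (Fin n) ℝ} :
    R ∈ reflectionManifold n k ↔ R.IsSymm ∧ R * R = 1 ∧ R.trace = (n : ℝ) - 2 * k := by
  unfold reflectionManifold
  simp only [Set.mem_ofPred_eq]
  refine and_congr_right fun _ => and_congr_right fun h => ?_
  have := aux_finrank h
  constructor
  · intro hk
    rw [hk] at this
    linarith
  · intro ht
    rw [ht] at this
    have h3 : (Module.finrank ℝ (LinearMap.ker (R + 1).mulVecLin) : ℝ) = k := by
      rw [this]; ring
    exact_mod_cast h3

lemma aux_dist {n : ℕ} {G R : Matrix (Fin n) (Fin n) ℝ} (hG : G.IsSymm) (hs : R.IsSymm)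
    (hR : R * R = 1) :
    frobDistSq G R = (n : ℝ) + (G * G).trace - 2 * (R * G).trace := by
  unfold frobDistSq
  rw [transpose_sub, hs.eq, hG.eq, sub_mul, mul_sub, mul_sub, hR]
  simp only [trace_sub, trace_one, Fintype.card_fin]
  rw [trace_mul_comm G R]
  ring

lemma aux_sum {n : ℕ} {v : Fin n → (Fin n → ℝ)}
    (hortho : ∀ i j, v i ⬝ᵥ v j = if i = j then (1 : ℝ) else 0) :
    ∑ i, vecMulVec (v i) (v i) = 1 := by
  have h1 : (Matrix.of v) * (Matrix.of v)ᵀ = 1 := by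
    ext i j
    rw [Matrix.mul_apply, Matrix.one_apply, ← hortho i j]
    rfl
  have h2 := mul_eq_one_comm.mp h1
  rw [← h2]
  ext i j
  rw [Matrix.sum_apply, Matrix.mul_apply]
  rfl

lemma aux_trace {n : ℕ} {v : Fin n → (Fin n → ℝ)}
    (hortho : ∀ i j, v i ⬝ᵥ v j = if i = j then (1 : ℝ) else 0)
    (M : Matrix (Fin n) (Fin n) ℝ) : M.trace = ∑ i, v i ⬝ᵥ (M *ᵥ v i) := by
  conv_lhs => rw [← mul_one M, ← aux_sum hortho, Finset.mul_sum, trace_sum]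
  refine Finset.sum_congr rfl fun i _ => ?_
  rw [mul_vecMulVec, trace_vecMulVec, dotProduct_comm]

lemma aux_ext {n : ℕ} {v : Fin n → (Fin n → ℝ)}
    (hortho : ∀ i j, v i ⬝ᵥ v j = if i = j then (1 : ℝ) else 0)
    {M N : Matrix (Fin n) (Fin n) ℝ} (h : ∀ i, M *ᵥ v i = N *ᵥ v i) : M = N := by
  rw [← mul_one M, ← mul_one N, ← aux_sum hortho, Finset.mul_sum, Finset.mul_sum]
  refine Finset.sum_congr rfl fun i _ => ?_
  rw [mul_vecMulVec, mul_vecMulVec, h]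

lemma aux_nonneg {n : ℕ} (a : Fin n → ℝ) : 0 ≤ a ⬝ᵥ a :=
  Finset.sum_nonneg fun i _ => mul_self_nonneg (a i)

lemma aux_pos {n : ℕ} {a : Fin n → ℝ} (h : a ≠ 0) : 0 < a ⬝ᵥ a :=
  lt_of_le_of_ne (aux_nonneg a) fun h0 => h (dotProduct_self_eq_zero.mp h0.symm)

lemma aux_plus {n : ℕ} {R : Matrix (Fin n) (Fin n) ℝ} (hs : R.IsSymm) (hR : R * R = 1)
    {a : Fin n → ℝ} (ha : a ⬝ᵥ a = 1) :
    (a + R *ᵥ a) ⬝ᵥ (a + R *ᵥ a) = 2 + 2 * (a ⬝ᵥ (R *ᵥ a)) := by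
  simp only [add_dotProduct, dotProduct_add, aux_sd hs, mulVec_mulVec, hR, one_mulVec, ha]
  ring

lemma aux_minus {n : ℕ} {R : Matrix (Fin n) (Fin n) ℝ} (hs : R.IsSymm) (hR : R * R = 1)
    {a : Fin n → ℝ} (ha : a ⬝ᵥ a = 1) :
    (a - R *ᵥ a) ⬝ᵥ (a - R *ᵥ a) = 2 - 2 * (a ⬝ᵥ (R *ᵥ a)) := by
  simp only [sub_dotProduct, dotProduct_sub, aux_sd hs, mulVec_mulVec, hR, one_mulVec, ha]
  ring

/-- The rotated reflection. -/
lemma aux_curve {n k : ℕ} {R : Matrix (Fin n) (Fin n) ℝ} (hR : R ∈ reflectionManifold n k)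
    {x y : Fin n → ℝ} (hx : R *ᵥ x = -x) (hy : R *ᵥ y = y) (hxx : x ⬝ᵥ x = 1)
    (hyy : y ⬝ᵥ y = 1) (c s : ℝ) (hcs : c ^ 2 + s ^ 2 = 1) :
    R + (2 : ℝ) • (s ^ 2 • vecMulVec x x - s ^ 2 • vecMulVec y y
      - (c * s) • (vecMulVec x y + vecMulVec y x)) ∈ reflectionManifold n k := by
  rw [aux_mem] at hR ⊢
  obtain ⟨hs, hRR, ht⟩ := hR
  have hxy : x ⬝ᵥ y = 0 := by
    have h1 : (R *ᵥ x) ⬝ᵥ y = x ⬝ᵥ (R *ᵥ y) := aux_sd hs x y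
    rw [hx, hy, neg_dotProduct] at h1
    linarith
  have hyx : y ⬝ᵥ x = 0 := by rw [dotProduct_comm, hxy]
  have hx' : x ᵥ* R = -x := by rw [← mulVec_transpose, hs.eq, hx]
  have hy' : y ᵥ* R = y := by rw [← mulVec_transpose, hs.eq, hy]
  refine ⟨?_, ?_, ?_⟩
  · unfold Matrix.IsSymm
    simp only [transpose_add, transpose_sub, transpose_smul, transpose_vecMulVec, hs.eq]
    rw [add_comm (vecMulVec y x)]
  · simp only [mul_add, add_mul, mul_sub, sub_mul, smul_mul_assoc, mul_smul_comm, hRR,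
      mul_vecMulVec, vecMulVec_mul, vecMulVec_mulVec, vecMul_vecMulVec, hx, hy, hx', hy',
      hxx, hyy, hxy, hyx, neg_vecMulVec, vecMulVec_neg, MulOpposite.op_one, MulOpposite.op_zero,
      one_smul, zero_smul, zero_vecMulVec, vecMulVec_zero, smul_zero]
    ext i j
    simp only [Matrix.add_apply, Matrix.sub_apply, Matrix.smul_apply, Matrix.neg_apply,
      Matrix.zero_apply, vecMulVec_apply, smul_eq_mul]
    linear_combination (4 * s ^ 2 * (x i * x j + y i * y j)) * hcs
  · simp [trace_add, trace_sub, trace_smul, trace_vecMulVec, hxx, hyy, hxy, hyx, ht]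

open Topology Filter in
lemma aux_first {n k : ℕ} {G R : Matrix (Fin n) (Fin n) ℝ} (hG : G.IsSymm)
    (hR : R ∈ reflectionManifold n k)
    (hmin : IsLocalMinOn (frobDistSq G) (reflectionManifold n k) R)
    {x y : Fin n → ℝ} (hx : R *ᵥ x = -x) (hy : R *ᵥ y = y) (hxx : x ⬝ᵥ x = 1)
    (hyy : y ⬝ᵥ y = 1) :
    x ⬝ᵥ (G *ᵥ y) = 0 ∧ x ⬝ᵥ (G *ᵥ x) ≤ y ⬝ᵥ (G *ᵥ y) := by
  let C : ℝ → Matrix (Fin n) (Fin n) ℝ := fun t =>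
    R + (2 : ℝ) • ((Real.sin t) ^ 2 • vecMulVec x x - (Real.sin t) ^ 2 • vecMulVec y y
      - (Real.cos t * Real.sin t) • (vecMulVec x y + vecMulVec y x))
  have hC0 : C 0 = R := by simp [C]
  have hCc : Continuous C := by
    have h1 := Real.continuous_sin
    have h2 := Real.continuous_cos
    fun_prop
  have hCm : ∀ t, C t ∈ reflectionManifold n k := fun t =>
    aux_curve hR hx hy hxx hyy _ _ (Real.cos_sq_add_sin_sq t)
  have htend : Tendsto C (𝓝 0) (𝓝[reflectionManifold n k] R) := by
    refine tendsto_nhdsWithin_iff.mpr ⟨?_, Eventually.of_forall hCm⟩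
    have := hCc.tendsto 0
    rwa [hC0] at this
  have hev : ∀ᶠ t in 𝓝 (0 : ℝ), frobDistSq G R ≤ frobDistSq G (C t) := htend.eventually hmin
  set α := x ⬝ᵥ (G *ᵥ y) with hα
  set β := y ⬝ᵥ (G *ᵥ y) - x ⬝ᵥ (G *ᵥ x) with hβ
  have hyx : y ⬝ᵥ (G *ᵥ x) = α := by rw [hα, ← aux_sd hG, dotProduct_comm]
  have hval : ∀ t, frobDistSq G (C t) - frobDistSq G R
      = 4 * (Real.sin t ^ 2 * β + 2 * (Real.cos t * Real.sin t) * α) := by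
    intro t
    have h1 := aux_mem.mp hR
    have h2 := aux_mem.mp (hCm t)
    rw [aux_dist hG h1.1 h1.2.1, aux_dist hG h2.1 h2.2.1]
    have e : ∀ a b : Fin n → ℝ, (vecMulVec a b * G).trace = b ⬝ᵥ (G *ᵥ a) := by
      intro a b
      rw [trace_mul_comm, mul_vecMulVec, trace_vecMulVec, dotProduct_comm]
    simp only [C, add_mul, sub_mul, smul_mul_assoc, trace_add, trace_sub, trace_smul, e, hyx,
      ← hα, smul_eq_mul, hβ]
    ring
  have hev2 : ∀ᶠ t in 𝓝 (0 : ℝ),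
      0 ≤ Real.sin t ^ 2 * β + 2 * (Real.cos t * Real.sin t) * α := by
    filter_upwards [hev] with t ht
    have := hval t
    linarith
  have hα0 : α = 0 := by
    have hd : HasDerivAt (fun t => Real.sin t ^ 2 * β + 2 * (Real.cos t * Real.sin t) * α)
        (2 * α) 0 := by
      have h1 := Real.hasDerivAt_sin 0
      have h2 := Real.hasDerivAt_cos 0
      have h3 := ((h1.pow 2).mul_const β).add (((h2.mul h1).const_mul 2).mul_const α)
      refine (h3.congr_deriv ?_)
      simp
    have hm : IsLocalMin (fun t => Real.sin t ^ 2 * β + 2 * (Real.cos t * Real.sin t) * α) 0 := by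
      filter_upwards [hev2] with t ht
      simpa using ht
    have := hm.hasDerivAt_eq_zero hd
    linarith
  refine ⟨hα0, ?_⟩
  have hev3 : ∀ᶠ t in 𝓝[>] (0 : ℝ), 0 ≤ Real.sin t ^ 2 * β := by
    filter_upwards [hev2.filter_mono nhdsWithin_le_nhds] with t ht
    simpa [hα0] using ht
  have hev4 : ∀ᶠ t in 𝓝[>] (0 : ℝ), t ∈ Set.Ioo 0 Real.pi :=
    Ioo_mem_nhdsGT Real.pi_pos
  obtain ⟨t, h1, h2⟩ := (hev3.and hev4).exists
  have h3 := Real.sin_pos_of_mem_Ioo h2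
  have h4 : 0 ≤ β := nonneg_of_mul_nonneg_right h1 (by positivity)
  linarith

lemma aux_second {n k : ℕ} {G R : Matrix (Fin n) (Fin n) ℝ} (hG : G.IsSymm)
    (hR : R ∈ reflectionManifold n k)
    (hmin : IsLocalMinOn (frobDistSq G) (reflectionManifold n k) R)
    {x y : Fin n → ℝ} (hx : R *ᵥ x = -x) (hy : R *ᵥ y = y) :
    x ⬝ᵥ (G *ᵥ y) = 0 ∧ (x ⬝ᵥ (G *ᵥ x)) * (y ⬝ᵥ y) ≤ (y ⬝ᵥ (G *ᵥ y)) * (x ⬝ᵥ x) := by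
  by_cases hx0 : x = 0
  · simp [hx0]
  by_cases hy0 : y = 0
  · simp [hy0]
  have px := aux_pos hx0
  have py := aux_pos hy0
  have sx : 0 < √(x ⬝ᵥ x) := Real.sqrt_pos.mpr px
  have sy : 0 < √(y ⬝ᵥ y) := Real.sqrt_pos.mpr py
  have qx : √(x ⬝ᵥ x) ^ 2 = x ⬝ᵥ x := Real.sq_sqrt px.le
  have qy : √(y ⬝ᵥ y) ^ 2 = y ⬝ᵥ y := Real.sq_sqrt py.le
  set p := √(x ⬝ᵥ x)
  set q := √(y ⬝ᵥ y)
  have key := aux_first hG hR hmin (x := p⁻¹ • x) (y := q⁻¹ • y)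
    (by rw [mulVec_smul, hx, smul_neg]) (by rw [mulVec_smul, hy])
    (by simp only [smul_dotProduct, dotProduct_smul, smul_eq_mul]; rw [← qx]; field_simp)
    (by simp only [smul_dotProduct, dotProduct_smul, smul_eq_mul]; rw [← qy]; field_simp)
  simp only [mulVec_smul, smul_dotProduct, dotProduct_smul, smul_eq_mul] at key
  obtain ⟨k1, k2⟩ := key
  constructor
  · have := sx.ne'
    have := sy.ne'
    rcases mul_eq_zero.mp k1 with h | h
    · exact absurd h (by positivity)
    rcases mul_eq_zero.mp h with h | h
    · exact absurd h (by positivity)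
    exact h
  · rw [← qx, ← qy]
    have h := mul_le_mul_of_nonneg_left k2 (by positivity : 0 ≤ p ^ 2 * q ^ 2)
    have e1 : p ^ 2 * q ^ 2 * (p⁻¹ * (p⁻¹ * (x ⬝ᵥ (G *ᵥ x)))) = (x ⬝ᵥ (G *ᵥ x)) * q ^ 2 := by
      field_simp
    have e2 : p ^ 2 * q ^ 2 * (q⁻¹ * (q⁻¹ * (y ⬝ᵥ (G *ᵥ y)))) = (y ⬝ᵥ (G *ᵥ y)) * p ^ 2 := by
      field_simp
    rwa [e1, e2] at h

lemma aux_comm {n k : ℕ} {G R : Matrix (Fin n) (Fin n) ℝ} (hG : G.IsSymm)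
    (hR : R ∈ reflectionManifold n k)
    (hmin : IsLocalMinOn (frobDistSq G) (reflectionManifold n k) R) : R * G = G * R := by
  obtain ⟨hs, hRR, -⟩ := aux_mem.mp hR
  have h0 : (1 - R) * (G * (1 + R)) = 0 := by
    apply Matrix.ext_of_mulVec_single
    intro j
    rw [zero_mulVec]
    set w : Fin n → ℝ := Pi.single j 1
    apply dotProduct_eq_zero
    intro u
    have := (aux_second hG hR hmin (x := u - R *ᵥ u) (y := w + R *ᵥ w)
      (by rw [mulVec_sub, mulVec_mulVec, hRR, one_mulVec]; abel)
      (by rw [mulVec_add, mulVec_mulVec, hRR, one_mulVec]; abel)).1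
    rw [dotProduct_comm, ← this, ← mulVec_mulVec, ← mulVec_mulVec, add_mulVec, sub_mulVec,
      one_mulVec, one_mulVec, dotProduct_sub, sub_dotProduct, aux_sd hs]
  have h1 := congrArg Matrix.transpose h0
  simp only [transpose_mul, transpose_add, transpose_sub, transpose_one, transpose_zero, hs.eq,
    hG.eq] at h1
  have h2 : (2 : ℝ) • (R * G) = (2 : ℝ) • (G * R) := by
    have e : (1 + R) * G * (1 - R) - (1 - R) * (G * (1 + R))
      = (2 : ℝ) • (R * G) - (2 : ℝ) • (G * R) := by
      rw [two_smul, two_smul]; noncomm_ring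
    rw [h0, h1, sub_zero] at e
    exact (sub_eq_zero.mp e.symm)
  exact smul_right_injective _ (two_ne_zero) h2

end Helpers

/-- Let `G` be a real symmetric `n × n` matrix with eigenvalues
`λ 0 ≤ λ 1 ≤ … ≤ λ (n-1)` (given here through an orthonormal eigenbasis `v` with
`G vᵢ = λᵢ vᵢ` and `λ` monotone), let `1 ≤ k < n` and `λ (k-1) < λ k` (0-based; i.e. the
`k`-th and `(k+1)`-st smallest eigenvalues are separated). Then `f(R) = ‖R − G‖_F²`,
restricted to `𝓡_k = {R ∈ Sym_n : R² = I, dim ker(R+I) = k}` (with the Frobenius-norm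
topology, which is the standard topology on matrices), has exactly one local minimum
point, namely `R* = I − 2P` where `P = ∑_{i<k} vᵢ vᵢᵀ` is the orthogonal projection onto
the sum of the eigenspaces of the `k` smallest eigenvalues. -/
theorem stmt3 {n k : ℕ} (hk1 : 1 ≤ k) (hkn : k < n)
    (G : Matrix (Fin n) (Fin n) ℝ) (hG : G.IsSymm)
    (lam : Fin n → ℝ) (v : Fin n → (Fin n → ℝ))
    (hortho : ∀ i j, v i ⬝ᵥ v j = if i = j then (1 : ℝ) else 0)
    (heig : ∀ i, G *ᵥ v i = lam i • v i)
    (hmono : Monotone lam)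
    (hgap : lam ⟨k - 1, by omega⟩ < lam ⟨k, hkn⟩) :
    (1 - (2 : ℝ) • ∑ i ∈ Finset.univ.filter (fun i : Fin n => (i : ℕ) < k),
        vecMulVec (v i) (v i)) ∈ reflectionManifold n k ∧
    IsLocalMinOn (frobDistSq G) (reflectionManifold n k)
      (1 - (2 : ℝ) • ∑ i ∈ Finset.univ.filter (fun i : Fin n => (i : ℕ) < k),
        vecMulVec (v i) (v i)) ∧
    ∀ R₀ ∈ reflectionManifold n k,
      IsLocalMinOn (frobDistSq G) (reflectionManifold n k) R₀ →
      R₀ = 1 - (2 : ℝ) • ∑ i ∈ Finset.univ.filter (fun i : Fin n => (i : ℕ) < k),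
        vecMulVec (v i) (v i) := by
  classical
  set P : Matrix (Fin n) (Fin n) ℝ :=
    ∑ i ∈ Finset.univ.filter (fun i : Fin n => (i : ℕ) < k), vecMulVec (v i) (v i) with hP
  have hvv : ∀ i, v i ⬝ᵥ v i = 1 := fun i => by simp [hortho]
  have hPv : ∀ j, P *ᵥ v j = if (j : ℕ) < k then v j else 0 := by
    intro j
    rw [hP, Matrix.sum_mulVec]
    simp only [vecMulVec_mulVec, hortho]
    rw [Finset.sum_filter, Finset.sum_eq_single j]
    · simp
    · intro b _ hb
      simp [hb]
    · simp
  set S : Matrix (Fin n) (Fin n) ℝ := 1 - (2 : ℝ) • P with hS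
  let r : Fin n → ℝ := fun i => if (i : ℕ) < k then -1 else 1
  have hSv : ∀ j, S *ᵥ v j = r j • v j := by
    intro j
    rw [hS, sub_mulVec, one_mulVec, smul_mulVec, hPv]
    simp only [r]
    split_ifs
    · module
    · simp
  have hPs : P.IsSymm := by
    unfold Matrix.IsSymm
    rw [hP, transpose_sum]
    simp only [transpose_vecMulVec]
  have hSs : S.IsSymm := by
    unfold Matrix.IsSymm
    rw [hS, transpose_sub, transpose_smul, hPs.eq, transpose_one]
  have hSS : S * S = 1 := by
    apply aux_ext hortho
    intro i
    rw [← mulVec_mulVec, hSv, mulVec_smul, hSv, smul_smul, one_mulVec]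
    simp only [r]
    split_ifs <;> simp
  have hrs : ∑ i, r i = (n : ℝ) - 2 * k := by
    have h1 : ∀ i, r i = 1 - 2 * (if (i : ℕ) < k then (1 : ℝ) else 0) := by
      intro i; simp only [r]; split_ifs <;> norm_num
    have hc : (Finset.univ.filter (fun i : Fin n => (i : ℕ) < k)).card = k := by
      rw [Fin.card_filter_val_lt]; omega
    rw [Finset.sum_congr rfl fun i _ => h1 i, Finset.sum_sub_distrib, ← Finset.mul_sum,
      Finset.sum_boole, hc]
    simp
  have hSt : S.trace = (n : ℝ) - 2 * k := by
    rw [aux_trace hortho, ← hrs]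
    refine Finset.sum_congr rfl fun i _ => ?_
    rw [hSv, dotProduct_smul, hvv, smul_eq_mul, mul_one]
  have hSm : S ∈ reflectionManifold n k := aux_mem.mpr ⟨hSs, hSS, hSt⟩
  have htrG : ∀ R : Matrix (Fin n) (Fin n) ℝ,
      (R * G).trace = ∑ i, lam i * (v i ⬝ᵥ (R *ᵥ v i)) := by
    intro R
    rw [aux_trace hortho]
    refine Finset.sum_congr rfl fun i _ => ?_
    rw [← mulVec_mulVec, heig, mulVec_smul, dotProduct_smul, smul_eq_mul]
  have hlow : ∀ R ∈ reflectionManifold n k, ∀ i, -1 ≤ v i ⬝ᵥ (R *ᵥ v i) := by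
    intro R hR i
    obtain ⟨hs, hRR, -⟩ := aux_mem.mp hR
    have h1 := aux_plus hs hRR (hvv i)
    have h2 := aux_nonneg (v i + R *ᵥ v i)
    linarith
  have hupp : ∀ R ∈ reflectionManifold n k, ∀ i, v i ⬝ᵥ (R *ᵥ v i) ≤ 1 := by
    intro R hR i
    obtain ⟨hs, hRR, -⟩ := aux_mem.mp hR
    have h1 := aux_minus hs hRR (hvv i)
    have h2 := aux_nonneg (v i - R *ᵥ v i)
    linarith
  have hsum : ∀ R ∈ reflectionManifold n k, ∑ i, (r i - v i ⬝ᵥ (R *ᵥ v i)) = 0 := by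
    intro R hR
    obtain ⟨hs, hRR, ht⟩ := aux_mem.mp hR
    rw [aux_trace hortho] at ht
    rw [Finset.sum_sub_distrib, hrs, ht, sub_self]
  refine ⟨hSm, ?_, ?_⟩
  · have hmin : IsMinOn (frobDistSq G) (reflectionManifold n k) S := by
      intro R hR
      obtain ⟨hs, hRR, ht⟩ := aux_mem.mp hR
      simp only [Set.mem_ofPred_eq]
      rw [aux_dist hG hs hRR, aux_dist hG hSs hSS, htrG R, htrG S]
      have h1 : 0 ≤ ∑ i, (lam i - lam ⟨k, hkn⟩) * (r i - v i ⬝ᵥ (R *ᵥ v i)) := by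
        refine Finset.sum_nonneg fun i _ => ?_
        by_cases hi : (i : ℕ) < k
        · have h2 : lam i ≤ lam ⟨k, hkn⟩ := hmono (Fin.le_def.mpr hi.le)
          have h3 := hlow R hR i
          simp only [r, hi, if_true]
          exact mul_nonneg_of_nonpos_of_nonpos (by linarith) (by linarith)
        · have h2 : lam ⟨k, hkn⟩ ≤ lam i := hmono (Fin.le_def.mpr (not_lt.mp hi))
          have h3 := hupp R hR i
          simp only [r, hi, if_false]
          exact mul_nonneg (by linarith) (by linarith)
      have h4 : ∑ i, (lam i - lam ⟨k, hkn⟩) * (r i - v i ⬝ᵥ (R *ᵥ v i))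
          = ∑ i, lam i * r i - ∑ i, lam i * (v i ⬝ᵥ (R *ᵥ v i)) := by
        have h5 := hsum R hR
        simp only [sub_mul, mul_sub, Finset.sum_sub_distrib, ← Finset.mul_sum] at h5 ⊢
        linear_combination (-lam ⟨k, hkn⟩) * h5
      have h6 : ∑ i, lam i * (v i ⬝ᵥ (S *ᵥ v i)) = ∑ i, lam i * r i := by
        refine Finset.sum_congr rfl fun i _ => ?_
        rw [hSv, dotProduct_smul, hvv, smul_eq_mul, mul_one]
      rw [h6]
      linarith
    exact hmin.localize
  · intro R hR hmin
    obtain ⟨hs, hRR, ht⟩ := aux_mem.mp hR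
    have hcomm := aux_comm hG hR hmin
    have hGR : ∀ i, G *ᵥ (R *ᵥ v i) = lam i • (R *ᵥ v i) := by
      intro i
      rw [mulVec_mulVec, ← hcomm, ← mulVec_mulVec, heig, mulVec_smul]
    have hcase : (∀ j : Fin n, k ≤ (j : ℕ) → v j - R *ᵥ v j = 0) ∨
        (∀ i : Fin n, (i : ℕ) < k → v i + R *ᵥ v i = 0) := by
      by_contra hcon
      push Not at hcon
      obtain ⟨⟨j, hj, hj0⟩, ⟨i, hi, hi0⟩⟩ := hcon
      have h1 := (aux_second hG hR hmin (x := v j - R *ᵥ v j) (y := v i + R *ᵥ v i)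
        (by rw [mulVec_sub, mulVec_mulVec, hRR, one_mulVec]; abel)
        (by rw [mulVec_add, mulVec_mulVec, hRR, one_mulVec]; abel)).2
      have e1 : G *ᵥ (v j - R *ᵥ v j) = lam j • (v j - R *ᵥ v j) := by
        rw [mulVec_sub, heig, hGR, smul_sub]
      have e2 : G *ᵥ (v i + R *ᵥ v i) = lam i • (v i + R *ᵥ v i) := by
        rw [mulVec_add, heig, hGR, smul_add]
      rw [e1, e2, dotProduct_smul, dotProduct_smul, smul_eq_mul, smul_eq_mul] at h1
      have p1 := aux_pos hj0
      have p2 := aux_pos hi0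
      have h2 : lam i ≤ lam ⟨k - 1, by omega⟩ := hmono (Fin.le_def.mpr (by simp; omega))
      have h3 : lam ⟨k, hkn⟩ ≤ lam j := hmono (Fin.le_def.mpr hj)
      have h4 : 0 < lam j - lam i := by linarith
      have h5 := mul_pos h4 (mul_pos p1 p2)
      nlinarith
    have hz : ∀ i, r i - v i ⬝ᵥ (R *ᵥ v i) = 0 := by
      have h0 := hsum R hR
      rcases hcase with h | h
      · have hn : ∀ i ∈ Finset.univ, r i - v i ⬝ᵥ (R *ᵥ v i) ≤ 0 := by
          intro i _
          by_cases hi : (i : ℕ) < k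
          · have := hlow R hR i
            simp only [r, hi, if_true]
            linarith
          · have h1 := h i (not_lt.mp hi)
            rw [← sub_eq_zero.mp h1, hvv]
            simp [r, hi]
        intro i
        exact (Finset.sum_eq_zero_iff_of_nonpos hn).mp h0 i (Finset.mem_univ i)
      · have hn : ∀ i ∈ Finset.univ, 0 ≤ r i - v i ⬝ᵥ (R *ᵥ v i) := by
          intro i _
          by_cases hi : (i : ℕ) < k
          · have h1 := h i hi
            rw [eq_neg_of_add_eq_zero_right h1, dotProduct_neg, hvv]
            simp [r, hi]
          · have := hupp R hR i
            simp only [r, hi, if_false]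
            linarith
        intro i
        exact (Finset.sum_eq_zero_iff_of_nonneg hn).mp h0 i (Finset.mem_univ i)
    apply aux_ext hortho
    intro i
    rw [hSv]
    have h1 := hz i
    by_cases hi : (i : ℕ) < k
    · simp only [r, hi, if_true] at h1 ⊢
      have h2 := aux_plus hs hRR (hvv i)
      have h3 : v i + R *ᵥ v i = 0 := dotProduct_self_eq_zero.mp (by rw [h2]; linarith)
      rw [eq_neg_of_add_eq_zero_right h3, neg_one_smul]
    · simp only [r, hi, if_false] at h1 ⊢
      have h2 := aux_minus hs hRR (hvv i)
      have h3 : v i - R *ᵥ v i = 0 := dotProduct_self_eq_zero.mp (by rw [h2]; linarith)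
      rw [one_smul, ← sub_eq_zero.mp h3]
end

section
/- Let G be a real symmetric n×n matrix with eigenvalues λ₁ ≤ λ₂ ≤ … ≤ λₙ listed in nondecreasing order with multiplicity, and let 1 ≤ k ≤ n−1. Suppose the k largest eigenvalues of G are strictly separated from the remaining ones, i.e. λ_{n−k} < λ_{n−k+1}. Then the function f(R) = ‖R − G‖_F², restricted to the set 𝓡_k = {R ∈ Sym_n : R² = I, dim ker(R + I) = k} (with the topology induced by the Frobenius norm), has exactly one local maximum point, namely R** = I − 2Q, where Q is the orthogonal projection onto the sum of the eigenspaces of G corresponding to the k largest eigenvalues λ_{n−k+1}, …, λₙ. -/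
open Matrix

namespace ReflAux

variable {n : ℕ}

lemma mem_iff {k : ℕ} (P : Matrix (Fin n) (Fin n) ℝ) :
    (1 - (2 : ℝ) • P) ∈ reflectionManifold n k ↔
      P.IsSymm ∧ P * P = P ∧ P.trace = k := by
  have h1 : (1 - (2 : ℝ) • P).IsSymm ↔ P.IsSymm := by
    unfold Matrix.IsSymm
    rw [transpose_sub, transpose_one, transpose_smul, sub_right_inj]
    exact smul_right_inj (two_ne_zero)
  have h2 : (1 - (2 : ℝ) • P) * (1 - (2 : ℝ) • P) = 1 ↔ P * P = P := by
    have e : (1 - (2 : ℝ) • P) * (1 - (2 : ℝ) • P) = 1 + (4 : ℝ) • (P * P - P) := by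
      simp only [sub_mul, mul_sub, one_mul, mul_one, smul_mul_assoc, mul_smul_comm]
      module
    rw [e]
    constructor
    · intro h
      have h' : (4 : ℝ) • (P * P - P) = 0 := by simpa using h
      have := (smul_eq_zero.mp h').resolve_left (by norm_num)
      exact sub_eq_zero.mp this
    · intro h
      simp [h]
  have h3 : P * P = P →
      (Module.finrank ℝ (LinearMap.ker ((1 - (2 : ℝ) • P) + 1).mulVecLin) : ℝ) = P.trace := by
    intro h
    have hp : LinearMap.IsProj (LinearMap.ker ((1 - (2 : ℝ) • P) + 1).mulVecLin)
        (Matrix.toLin' P) := by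
      constructor
      · intro x
        simp only [LinearMap.mem_ker, mulVecLin_apply, toLin'_apply, mulVec_mulVec]
        have : (1 - (2 : ℝ) • P + 1) * P = 0 := by
          simp only [sub_mul, add_mul, one_mul, smul_mul_assoc, h]
          module
        rw [this, zero_mulVec]
      · intro x hx
        simp only [LinearMap.mem_ker, mulVecLin_apply, add_mulVec, sub_mulVec, one_mulVec,
          smul_mulVec] at hx
        rw [toLin'_apply]
        have h' : (2 : ℝ) • (x - P *ᵥ x) = 0 := by rw [← hx]; module
        have := (smul_eq_zero.mp h').resolve_left (by norm_num)
        exact (sub_eq_zero.mp this).symm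
    rw [← hp.trace, Matrix.trace_toLin'_eq]
  unfold reflectionManifold
  rw [Set.mem_ofPred_eq, h1, h2]
  constructor
  · rintro ⟨a, b, c⟩
    exact ⟨a, b, by rw [← h3 b, c]⟩
  · rintro ⟨a, b, c⟩
    refine ⟨a, b, ?_⟩
    have := h3 b
    rw [c] at this
    exact_mod_cast this

lemma frob_eq (G P : Matrix (Fin n) (Fin n) ℝ) (hG : G.IsSymm) (hs : P.IsSymm)
    (hp : P * P = P) :
    frobDistSq G (1 - (2 : ℝ) • P) =
      ((1 : Matrix (Fin n) (Fin n) ℝ) - (2 : ℝ) • G + G * G).trace + 4 * (P * G).trace := by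
  unfold frobDistSq
  have ht : (1 - (2 : ℝ) • P - G)ᵀ = 1 - (2 : ℝ) • P - G := by
    rw [transpose_sub, transpose_sub, transpose_one, transpose_smul, hs.eq, hG.eq]
  rw [ht]
  have e : (1 - (2 : ℝ) • P - G) * (1 - (2 : ℝ) • P - G) =
      (1 - (2 : ℝ) • G + G * G) + ((2 : ℝ) • (P * G) + (2 : ℝ) • (G * P)) := by
    simp only [sub_mul, mul_sub, one_mul, mul_one, smul_mul_assoc, mul_smul_comm, hp]
    module
  rw [e, trace_add _ (_ + _), trace_add ((2 : ℝ) • (P * G)), trace_smul, trace_smul, trace_mul_comm G P]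
  simp only [smul_eq_mul]
  ring

lemma resolution (v : Fin n → (Fin n → ℝ))
    (hortho : ∀ i j, v i ⬝ᵥ v j = if i = j then (1 : ℝ) else 0) :
    ∑ i, vecMulVec (v i) (v i) = 1 := by
  have h : (Matrix.of v) * (Matrix.of v)ᵀ = 1 := by
    ext i j
    simpa [Matrix.mul_apply, Matrix.one_apply, dotProduct] using hortho i j
  have h' := mul_eq_one_comm.mp h
  rw [← h']
  ext i j
  simp [Matrix.sum_apply, vecMulVec_apply, Matrix.mul_apply]

lemma expand (v : Fin n → (Fin n → ℝ))
    (hortho : ∀ i j, v i ⬝ᵥ v j = if i = j then (1 : ℝ) else 0)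
    (M : Matrix (Fin n) (Fin n) ℝ) :
    M = ∑ i, vecMulVec (M *ᵥ v i) (v i) := by
  conv_lhs => rw [← mul_one M, ← resolution v hortho, Finset.mul_sum]
  simp only [mul_vecMulVec]

lemma trace_expand (v : Fin n → (Fin n → ℝ))
    (hortho : ∀ i j, v i ⬝ᵥ v j = if i = j then (1 : ℝ) else 0)
    (M : Matrix (Fin n) (Fin n) ℝ) :
    M.trace = ∑ i, v i ⬝ᵥ M *ᵥ v i := by
  conv_lhs => rw [expand v hortho M, trace_sum]
  simp only [trace_vecMulVec]
  exact Finset.sum_congr rfl fun i _ => dotProduct_comm _ _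

lemma symm_dot {M : Matrix (Fin n) (Fin n) ℝ} (hM : M.IsSymm) (x y : Fin n → ℝ) :
    (M *ᵥ x) ⬝ᵥ y = x ⬝ᵥ M *ᵥ y := by
  rw [dotProduct_mulVec, ← mulVec_transpose, hM.eq]

lemma proj_dot {P : Matrix (Fin n) (Fin n) ℝ} (hs : P.IsSymm) (hp : P * P = P)
    (x : Fin n → ℝ) : x ⬝ᵥ P *ᵥ x = (P *ᵥ x) ⬝ᵥ (P *ᵥ x) := by
  rw [symm_dot hs, mulVec_mulVec, hp]

lemma proj_dot' {P : Matrix (Fin n) (Fin n) ℝ} (hs : P.IsSymm) (hp : P * P = P)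
    (x : Fin n → ℝ) : x ⬝ᵥ x - x ⬝ᵥ P *ᵥ x = (x - P *ᵥ x) ⬝ᵥ (x - P *ᵥ x) := by
  rw [sub_dotProduct, dotProduct_sub, dotProduct_sub, ← proj_dot hs hp, symm_dot hs]
  ring

lemma dot_nonneg (x : Fin n → ℝ) : 0 ≤ x ⬝ᵥ x :=
  Finset.sum_nonneg fun i _ => mul_self_nonneg (x i)

/-- Variation along a rational curve. -/
lemma curve {k : ℕ} {G P : Matrix (Fin n) (Fin n) ℝ} (hG : G.IsSymm)
    (hs : P.IsSymm) (hp : P * P = P) (htr : P.trace = k)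
    (hloc : IsLocalMaxOn (frobDistSq G) (reflectionManifold n k) (1 - (2 : ℝ) • P))
    {x y : Fin n → ℝ} (hx : P *ᵥ x = x) (hy : P *ᵥ y = 0)
    (hxx : x ⬝ᵥ x = 1) (hyy : y ⬝ᵥ y = 1) :
    x ⬝ᵥ G *ᵥ y = 0 ∧ y ⬝ᵥ G *ᵥ y ≤ x ⬝ᵥ G *ᵥ x := by
  have hxy : x ⬝ᵥ y = 0 := by
    rw [← hx, symm_dot hs, hy, dotProduct_zero]
  have hyx : y ⬝ᵥ x = 0 := by rw [dotProduct_comm, hxy]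
  let z : ℝ → (Fin n → ℝ) := fun t => x + t • y
  let C : ℝ → Matrix (Fin n) (Fin n) ℝ := fun t =>
    P - vecMulVec x x + (1 + t ^ 2)⁻¹ • vecMulVec (z t) (z t)
  have hzz : ∀ t, z t ⬝ᵥ z t = 1 + t ^ 2 := by
    intro t
    simp only [z, add_dotProduct, dotProduct_add, smul_dotProduct, dotProduct_smul, hxx, hyy,
      hxy, hyx, smul_eq_mul]
    ring
  have hpos : ∀ t : ℝ, 0 < 1 + t ^ 2 := fun t => by positivity
  have hCs : ∀ t, (C t).IsSymm := by
    intro t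
    simp only [C, Matrix.IsSymm, transpose_add, transpose_sub, transpose_smul, hs.eq,
      transpose_vecMulVec]
  have hA : (P - vecMulVec x x) * (P - vecMulVec x x) = P - vecMulVec x x := by
    have h1 : P * vecMulVec x x = vecMulVec x x := by rw [mul_vecMulVec, hx]
    have h2 : vecMulVec x x * P = vecMulVec x x := by
      rw [vecMulVec_mul, ← mulVec_transpose, hs.eq, hx]
    have h3 : vecMulVec x x * vecMulVec x x = vecMulVec x x := by
      rw [vecMulVec_mul_vecMulVec, hxx, one_smul]
    simp only [sub_mul, mul_sub, hp, h1, h2, h3]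
    abel
  have hAs : (P - vecMulVec x x)ᵀ = P - vecMulVec x x := by
    simp only [transpose_sub, hs.eq, transpose_vecMulVec]
  have hAz : ∀ t, (P - vecMulVec x x) *ᵥ z t = 0 := by
    intro t
    simp only [z, sub_mulVec, mulVec_add, mulVec_smul, hx, hy, vecMulVec_mulVec, hxx, hxy]
    simp
  have hCp : ∀ t, C t * C t = C t := by
    intro t
    have h1 : (P - vecMulVec x x) * vecMulVec (z t) (z t) = 0 := by
      rw [mul_vecMulVec, hAz, zero_vecMulVec]
    have h2 : vecMulVec (z t) (z t) * (P - vecMulVec x x) = 0 := by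
      rw [vecMulVec_mul, ← mulVec_transpose, hAs, hAz, vecMulVec_zero]
    have h3 : vecMulVec (z t) (z t) * vecMulVec (z t) (z t)
        = (1 + t ^ 2) • vecMulVec (z t) (z t) := by
      rw [vecMulVec_mul_vecMulVec, hzz, vecMulVec_smul]
    simp only [C]
    rw [add_mul, mul_add, mul_add, hA, mul_smul_comm, h1, smul_mul_assoc, h2, smul_mul_assoc,
      mul_smul_comm, h3, inv_smul_smul₀ (hpos t).ne']
    simp
  have hCt : ∀ t, (C t).trace = k := by
    intro t
    simp only [C, trace_add, trace_sub, trace_smul, trace_vecMulVec, hzz, hxx, htr, smul_eq_mul]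
    rw [inv_mul_cancel₀ (hpos t).ne']
    ring
  have hC0 : C 0 = P := by simp [C, z]
  have hcont : Continuous fun t : ℝ => (1 - (2 : ℝ) • C t) := by
    have hz : Continuous z := by fun_prop
    have hc : Continuous fun t : ℝ => (1 + t ^ 2)⁻¹ :=
      Continuous.inv₀ (by fun_prop) fun t => (hpos t).ne'
    have hvv : Continuous fun t : ℝ => vecMulVec (z t) (z t) := hz.matrix_vecMulVec hz
    exact continuous_const.sub ((continuous_const.add (hc.smul hvv)).const_smul (2 : ℝ))
  have htend : Filter.Tendsto (fun t : ℝ => (1 - (2 : ℝ) • C t)) (nhds 0)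
      (nhdsWithin (1 - (2 : ℝ) • P) (reflectionManifold n k)) := by
    refine tendsto_nhdsWithin_iff.mpr ⟨?_, Filter.Eventually.of_forall fun t =>
      (mem_iff _).mpr ⟨hCs t, hCp t, hCt t⟩⟩
    have := hcont.tendsto 0
    rwa [hC0] at this
  have hev := htend.eventually hloc
  have hGyx : y ⬝ᵥ G *ᵥ x = x ⬝ᵥ G *ᵥ y := by
    rw [← symm_dot hG, dotProduct_comm]
  have hev2 : ∀ᶠ t : ℝ in nhds 0,
      2 * t * (x ⬝ᵥ G *ᵥ y) + t ^ 2 * (y ⬝ᵥ G *ᵥ y - x ⬝ᵥ G *ᵥ x) ≤ 0 := by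
    filter_upwards [hev] with t ht
    rw [frob_eq G _ hG (hCs t) (hCp t), frob_eq G _ hG hs hp] at ht
    have e : (C t * G).trace = (P * G).trace - x ⬝ᵥ G *ᵥ x
        + (1 + t ^ 2)⁻¹ * (z t ⬝ᵥ G *ᵥ z t) := by
      simp only [C, add_mul, sub_mul, smul_mul_assoc, trace_add, trace_sub, trace_smul,
        smul_eq_mul, vecMulVec_mul, trace_vecMulVec, ← mulVec_transpose, hG.eq]
    have e2 : z t ⬝ᵥ G *ᵥ z t = x ⬝ᵥ G *ᵥ x + 2 * t * (x ⬝ᵥ G *ᵥ y)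
        + t ^ 2 * (y ⬝ᵥ G *ᵥ y) := by
      simp only [z, mulVec_add, mulVec_smul, add_dotProduct, dotProduct_add, smul_dotProduct,
        dotProduct_smul, smul_eq_mul, hGyx]
      ring
    have h4 : (1 + t ^ 2)⁻¹ * (z t ⬝ᵥ G *ᵥ z t) ≤ x ⬝ᵥ G *ᵥ x := by linarith
    rw [inv_mul_le_iff₀ (hpos t), e2] at h4
    linarith
  obtain ⟨ε, hε, hball⟩ := Metric.eventually_nhds_iff.mp hev2
  generalize x ⬝ᵥ G *ᵥ y = b at *
  generalize y ⬝ᵥ G *ᵥ y = d at *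
  generalize x ⬝ᵥ G *ᵥ x = a at *
  have key : ∀ t : ℝ, |t| < ε → 2 * t * b + t ^ 2 * (d - a) ≤ 0 := fun t ht =>
    hball (by simpa using ht)
  have hda : d ≤ a := by
    have h1 := key (ε / 2) (by rw [abs_of_pos (by linarith)]; linarith)
    have h2 := key (-(ε / 2)) (by rw [abs_neg, abs_of_pos (by linarith)]; linarith)
    have h3 : ε ^ 2 * (d - a) ≤ 0 := by nlinarith
    have : d - a ≤ 0 := by
      by_contra hc
      push Not at hc
      have := mul_pos (pow_pos hε 2) hc
      linarith
    linarith
  refine ⟨?_, hda⟩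
  have hb : ∀ t : ℝ, 0 < t → t < ε → 2 * |b| ≤ t * (a - d) := by
    intro t ht hte
    have h1 := key t (by rwa [abs_of_pos ht])
    have h2 := key (-t) (by rwa [abs_neg, abs_of_pos ht])
    have h1' : t * (2 * b) ≤ t * (t * (a - d)) := by nlinarith
    have h2' : t * (-(2 * b)) ≤ t * (t * (a - d)) := by nlinarith
    have h1'' := le_of_mul_le_mul_left h1' ht
    have h2'' := le_of_mul_le_mul_left h2' ht
    rcases abs_cases b with ⟨h, _⟩ | ⟨h, _⟩ <;> rw [h] <;> linarith
  by_contra hb0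
  have hbp : 0 < |b| := abs_pos.mpr hb0
  have hda' : 0 < a - d + 1 := by linarith
  have ht0 : 0 < min (ε / 2) (|b| / (a - d + 1)) := lt_min (by linarith) (by positivity)
  have h5 := hb _ ht0 (lt_of_le_of_lt (min_le_left _ _) (by linarith))
  have h6 : min (ε / 2) (|b| / (a - d + 1)) * (a - d) ≤ |b| / (a - d + 1) * (a - d) :=
    mul_le_mul_of_nonneg_right (min_le_right _ _) (by linarith)
  have h7 : |b| / (a - d + 1) * (a - d) ≤ |b| := by
    rw [div_mul_eq_mul_div, div_le_iff₀ hda']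
    nlinarith
  linarith

/-- Homogeneous version. -/
lemma curve' {k : ℕ} {G P : Matrix (Fin n) (Fin n) ℝ} (hG : G.IsSymm)
    (hs : P.IsSymm) (hp : P * P = P) (htr : P.trace = k)
    (hloc : IsLocalMaxOn (frobDistSq G) (reflectionManifold n k) (1 - (2 : ℝ) • P))
    {x y : Fin n → ℝ} (hx : P *ᵥ x = x) (hy : P *ᵥ y = 0) (hx0 : x ≠ 0) (hy0 : y ≠ 0) :
    x ⬝ᵥ G *ᵥ y = 0 ∧ (y ⬝ᵥ G *ᵥ y) * (x ⬝ᵥ x) ≤ (x ⬝ᵥ G *ᵥ x) * (y ⬝ᵥ y) := by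
  have hxx : 0 < x ⬝ᵥ x := lt_of_le_of_ne (dot_nonneg x)
    (fun h => hx0 (dotProduct_self_eq_zero.mp h.symm))
  have hyy : 0 < y ⬝ᵥ y := lt_of_le_of_ne (dot_nonneg y)
    (fun h => hy0 (dotProduct_self_eq_zero.mp h.symm))
  obtain ⟨r, hr, hr2⟩ : ∃ r : ℝ, 0 < r ∧ r * r * (x ⬝ᵥ x) = 1 := by
    refine ⟨(√(x ⬝ᵥ x))⁻¹, by positivity, ?_⟩
    rw [← mul_inv, Real.mul_self_sqrt hxx.le, inv_mul_cancel₀ hxx.ne']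
  obtain ⟨s, hs0, hs2⟩ : ∃ r : ℝ, 0 < r ∧ r * r * (y ⬝ᵥ y) = 1 := by
    refine ⟨(√(y ⬝ᵥ y))⁻¹, by positivity, ?_⟩
    rw [← mul_inv, Real.mul_self_sqrt hyy.le, inv_mul_cancel₀ hyy.ne']
  have h := curve hG hs hp htr hloc (x := r • x) (y := s • y)
    (by rw [mulVec_smul, hx]) (by rw [mulVec_smul, hy, smul_zero])
    (by simp only [smul_dotProduct, dotProduct_smul, smul_eq_mul]; linarith)
    (by simp only [smul_dotProduct, dotProduct_smul, smul_eq_mul]; linarith)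
  simp only [mulVec_smul, smul_dotProduct, dotProduct_smul, smul_eq_mul] at h
  obtain ⟨h1, h2⟩ := h
  constructor
  · simpa [hr.ne', hs0.ne'] using h1
  · have e1 : r * r = (x ⬝ᵥ x)⁻¹ := eq_inv_of_mul_eq_one_left hr2
    have e2 : s * s = (y ⬝ᵥ y)⁻¹ := eq_inv_of_mul_eq_one_left hs2
    rw [← mul_assoc, ← mul_assoc, e1, e2, inv_mul_le_iff₀ hyy, ← mul_assoc,
      mul_comm (y ⬝ᵥ y), mul_assoc, le_inv_mul_iff₀ hxx] at h2
    linarith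

lemma Q_mulVec (v : Fin n → (Fin n → ℝ))
    (hortho : ∀ i j, v i ⬝ᵥ v j = if i = j then (1 : ℝ) else 0) (S : Finset (Fin n))
    (j : Fin n) :
    (∑ i ∈ S, vecMulVec (v i) (v i)) *ᵥ v j = if j ∈ S then v j else 0 := by
  rw [sum_mulVec]
  simp only [vecMulVec_mulVec, hortho]
  have : ∀ i, MulOpposite.op (if i = j then (1 : ℝ) else 0) • v i
      = if i = j then v j else 0 := by
    intro i
    split_ifs with h
    · subst h; simp
    · simp
  simp only [this, Finset.sum_ite_eq']

end ReflAux

/-- Let `G` be a real symmetric `n × n` matrix with eigenvalues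
`λ 0 ≤ λ 1 ≤ … ≤ λ (n-1)` (given here through an orthonormal eigenbasis `v` with
`G vᵢ = λᵢ vᵢ` and `λ` monotone), let `1 ≤ k < n`, and suppose the `k` largest
eigenvalues are strictly separated from the remaining ones: `λ (n-k-1) < λ (n-k)`
(0-based). Then `f(R) = ‖R − G‖_F²`, restricted to
`𝓡_k = {R ∈ Sym_n : R² = I, dim ker(R+I) = k}` (with the Frobenius-norm topology,
which is the standard topology on matrices), has exactly one local maximum point,
namely `R** = I − 2Q` where `Q = ∑_{i ≥ n-k} vᵢ vᵢᵀ` is the orthogonal projection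
onto the sum of the eigenspaces of the `k` largest eigenvalues. -/
theorem stmt4 {n k : ℕ} (hk1 : 1 ≤ k) (hkn : k < n)
    (G : Matrix (Fin n) (Fin n) ℝ) (hG : G.IsSymm)
    (lam : Fin n → ℝ) (v : Fin n → (Fin n → ℝ))
    (hortho : ∀ i j, v i ⬝ᵥ v j = if i = j then (1 : ℝ) else 0)
    (heig : ∀ i, G *ᵥ v i = lam i • v i)
    (hmono : Monotone lam)
    (hgap : lam ⟨n - k - 1, by omega⟩ < lam ⟨n - k, by omega⟩) :
    (1 - (2 : ℝ) • ∑ i ∈ Finset.univ.filter (fun i : Fin n => n - k ≤ (i : ℕ)),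
        vecMulVec (v i) (v i)) ∈ reflectionManifold n k ∧
    IsLocalMaxOn (frobDistSq G) (reflectionManifold n k)
      (1 - (2 : ℝ) • ∑ i ∈ Finset.univ.filter (fun i : Fin n => n - k ≤ (i : ℕ)),
        vecMulVec (v i) (v i)) ∧
    ∀ R₀ ∈ reflectionManifold n k,
      IsLocalMaxOn (frobDistSq G) (reflectionManifold n k) R₀ →
      R₀ = 1 - (2 : ℝ) • ∑ i ∈ Finset.univ.filter (fun i : Fin n => n - k ≤ (i : ℕ)),
        vecMulVec (v i) (v i) := by
  classical
  set S : Finset (Fin n) := Finset.univ.filter (fun i : Fin n => n - k ≤ (i : ℕ)) with hS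
  set Q := ∑ i ∈ S, vecMulVec (v i) (v i) with hQ
  have hQv : ∀ j, Q *ᵥ v j = if j ∈ S then v j else 0 := ReflAux.Q_mulVec v hortho S
  have hcard : S.card = k := by
    have : S = Finset.Ici (⟨n - k, by omega⟩ : Fin n) := by
      ext i
      simp [hS, Fin.le_def]
    rw [this, Fin.card_Ici]
    simp only
    omega
  have hQs : Q.IsSymm := by
    simp only [hQ, Matrix.IsSymm, transpose_sum, transpose_vecMulVec]
  have hext : ∀ A B : Matrix (Fin n) (Fin n) ℝ, (∀ j, A *ᵥ v j = B *ᵥ v j) → A = B := by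
    intro A B h
    rw [ReflAux.expand v hortho A, ReflAux.expand v hortho B]
    simp only [h]
  have hQp : Q * Q = Q := by
    apply hext
    intro j
    rw [← mulVec_mulVec, hQv]
    split_ifs with h
    · rw [hQv, if_pos h]
    · simp
  have hvv : ∀ i, v i ⬝ᵥ v i = 1 := fun i => by rw [hortho, if_pos rfl]
  have hq : ∀ i, v i ⬝ᵥ Q *ᵥ v i = if i ∈ S then 1 else 0 := by
    intro i
    rw [hQv]
    split_ifs <;> simp [hvv]
  have hQt : Q.trace = k := by
    rw [ReflAux.trace_expand v hortho]
    simp only [hq]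
    simp [hcard]
  have hQmem : (1 - (2 : ℝ) • Q) ∈ reflectionManifold n k :=
    (ReflAux.mem_iff Q).mpr ⟨hQs, hQp, hQt⟩
  have hrep : ∀ R : Matrix (Fin n) (Fin n) ℝ, ∃ P, R = 1 - (2 : ℝ) • P := by
    intro R
    exact ⟨(1 / 2 : ℝ) • (1 - R), by module⟩
  have htrG : ∀ P : Matrix (Fin n) (Fin n) ℝ,
      (P * G).trace = ∑ i, lam i * (v i ⬝ᵥ P *ᵥ v i) := by
    intro P
    rw [ReflAux.trace_expand v hortho]
    refine Finset.sum_congr rfl fun i _ => ?_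
    rw [← mulVec_mulVec, heig, mulVec_smul, dotProduct_smul, smul_eq_mul]
  have hp0 : ∀ P : Matrix (Fin n) (Fin n) ℝ, P.IsSymm → P * P = P →
      ∀ i, 0 ≤ v i ⬝ᵥ P *ᵥ v i := by
    intro P hs hp i
    rw [ReflAux.proj_dot hs hp]
    exact ReflAux.dot_nonneg _
  have hp1 : ∀ P : Matrix (Fin n) (Fin n) ℝ, P.IsSymm → P * P = P →
      ∀ i, v i ⬝ᵥ P *ᵥ v i ≤ 1 := by
    intro P hs hp i
    have h := ReflAux.proj_dot' hs hp (v i)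
    have h2 := ReflAux.dot_nonneg (v i - P *ᵥ v i)
    rw [hvv] at h
    linarith
  have hmemS : ∀ i : Fin n, i ∈ S ↔ n - k ≤ (i : ℕ) := by
    intro i
    simp [hS]
  refine ⟨hQmem, ?_, ?_⟩
  · refine IsMaxOn.localize ?_
    intro R hR
    obtain ⟨P, rfl⟩ := hrep R
    obtain ⟨hs, hp, ht⟩ := (ReflAux.mem_iff P).mp hR
    rw [Set.mem_ofPred_eq, ReflAux.frob_eq G P hG hs hp, ReflAux.frob_eq G Q hG hQs hQp]
    have hsum : ∑ i, (v i ⬝ᵥ Q *ᵥ v i - v i ⬝ᵥ P *ᵥ v i) = 0 := by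
      rw [Finset.sum_sub_distrib, ← ReflAux.trace_expand v hortho,
        ← ReflAux.trace_expand v hortho, hQt, ht, sub_self]
    have hge : 0 ≤ ∑ i, (lam i - lam ⟨n - k, by omega⟩) *
        (v i ⬝ᵥ Q *ᵥ v i - v i ⬝ᵥ P *ᵥ v i) := by
      refine Finset.sum_nonneg fun i _ => ?_
      rw [hq]
      split_ifs with h
      · refine mul_nonneg (sub_nonneg.mpr (hmono ?_)) (sub_nonneg.mpr (hp1 P hs hp i))
        exact Fin.le_def.mpr ((hmemS i).mp h)
      · refine mul_nonneg_of_nonpos_of_nonpos (sub_nonpos.mpr (hmono ?_)) ?_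
        · rw [hmemS] at h
          exact Fin.le_def.mpr (by simp only; omega)
        · have := hp0 P hs hp i
          linarith
    simp only [sub_mul] at hge
    rw [Finset.sum_sub_distrib, ← Finset.mul_sum, hsum] at hge
    simp only [mul_sub] at hge
    rw [Finset.sum_sub_distrib, ← htrG, ← htrG] at hge
    linarith
  · intro R hR hloc
    obtain ⟨P, rfl⟩ := hrep R
    obtain ⟨hs, hp, ht⟩ := (ReflAux.mem_iff P).mp hR
    have hPP : ∀ x, P *ᵥ (P *ᵥ x) = P *ᵥ x := fun x => by rw [mulVec_mulVec, hp]
    have hPN : ∀ x, P *ᵥ (x - P *ᵥ x) = 0 := fun x => by rw [mulVec_sub, hPP, sub_self]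
    have horth : ∀ x y, (P *ᵥ x) ⬝ᵥ G *ᵥ (y - P *ᵥ y) = 0 := by
      intro x y
      by_cases hx : P *ᵥ x = 0
      · rw [hx, zero_dotProduct]
      by_cases hy : y - P *ᵥ y = 0
      · rw [hy, mulVec_zero, dotProduct_zero]
      exact (ReflAux.curve' hG hs hp ht hloc (hPP x) (hPN y) hx hy).1
    have hcomm : ∀ y, P *ᵥ (G *ᵥ y) = G *ᵥ (P *ᵥ y) := by
      have h1 : ∀ y, P *ᵥ (G *ᵥ (y - P *ᵥ y)) = 0 := by
        intro y
        rw [← dotProduct_self_eq_zero, ← ReflAux.proj_dot hs hp, ← ReflAux.symm_dot hs]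
        exact horth _ _
      have h2 : P * G * (1 - P) = 0 := by
        apply hext
        intro j
        rw [← mulVec_mulVec, ← mulVec_mulVec, sub_mulVec, one_mulVec, h1, zero_mulVec]
      have h3 : P * G = P * G * P := by
        rw [mul_sub, mul_one] at h2
        exact sub_eq_zero.mp h2
      have h4 : G * P = P * G * P := by
        have := congrArg transpose h3
        rwa [transpose_mul, transpose_mul, transpose_mul, hs.eq, hG.eq, ← mul_assoc] at this
      intro y
      rw [mulVec_mulVec, mulVec_mulVec, h3, h4]
    have hGP : ∀ i, G *ᵥ (P *ᵥ v i) = lam i • (P *ᵥ v i) := by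
      intro i
      rw [← hcomm, heig, mulVec_smul]
    have hGN : ∀ i, G *ᵥ (v i - P *ᵥ v i) = lam i • (v i - P *ᵥ v i) := by
      intro i
      rw [mulVec_sub, hGP, heig, smul_sub]
    have hkey : ∀ i j, P *ᵥ v i ≠ 0 → v j - P *ᵥ v j ≠ 0 → lam j ≤ lam i := by
      intro i j hi hj
      have h := (ReflAux.curve' hG hs hp ht hloc (hPP (v i)) (hPN (v j)) hi hj).2
      rw [hGP, hGN, dotProduct_smul, dotProduct_smul, smul_eq_mul, smul_eq_mul] at h
      have hxx : 0 < (P *ᵥ v i) ⬝ᵥ (P *ᵥ v i) := lt_of_le_of_ne (ReflAux.dot_nonneg _)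
        (fun h => hi (dotProduct_self_eq_zero.mp h.symm))
      have hyy : 0 < (v j - P *ᵥ v j) ⬝ᵥ (v j - P *ᵥ v j) :=
        lt_of_le_of_ne (ReflAux.dot_nonneg _)
          (fun h => hj (dotProduct_self_eq_zero.mp h.symm))
      refine le_of_mul_le_mul_right ?_ (mul_pos hxx hyy)
      linarith
    have hdich : (∀ i, i ∉ S → P *ᵥ v i = 0) ∨ (∀ j, j ∈ S → v j - P *ᵥ v j = 0) := by
      by_contra hc
      push Not at hc
      obtain ⟨⟨i, hi, hi0⟩, j, hj, hj0⟩ := hc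
      have h := hkey i j hi0 hj0
      rw [hmemS] at hi hj
      have ha : lam i ≤ lam ⟨n - k - 1, by omega⟩ :=
        hmono (Fin.le_def.mpr (by simp only; omega))
      have hb : lam ⟨n - k, by omega⟩ ≤ lam j := hmono (Fin.le_def.mpr hj)
      linarith
    have hsum : ∑ i, (v i ⬝ᵥ Q *ᵥ v i - v i ⬝ᵥ P *ᵥ v i) = 0 := by
      rw [Finset.sum_sub_distrib, ← ReflAux.trace_expand v hortho,
        ← ReflAux.trace_expand v hortho, hQt, ht, sub_self]
    have hdiag : ∀ i, v i ⬝ᵥ P *ᵥ v i = if i ∈ S then 1 else 0 := by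
      rcases hdich with hd | hd
      · have := (Finset.sum_eq_zero_iff_of_nonneg (fun i _ => ?_)).mp hsum
        · intro i
          have := this i (Finset.mem_univ i)
          rw [hq] at this
          linarith
        · rw [hq]
          split_ifs with h
          · exact sub_nonneg.mpr (hp1 P hs hp i)
          · rw [hd i h]; simp
      · have := (Finset.sum_eq_zero_iff_of_nonpos (fun i _ => ?_)).mp hsum
        · intro i
          have := this i (Finset.mem_univ i)
          rw [hq] at this
          linarith
        · rw [hq]
          split_ifs with h
          · rw [← sub_eq_zero.mp (hd i h), hvv, sub_self]
          · have := hp0 P hs hp i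
            linarith
    have : P = Q := by
      apply hext
      intro j
      rw [hQv]
      have h := hdiag j
      split_ifs at h ⊢ with hj
      · have h2 := ReflAux.proj_dot' hs hp (v j)
        rw [hvv, h, sub_self] at h2
        exact (sub_eq_zero.mp (dotProduct_self_eq_zero.mp h2.symm)).symm
      · rw [ReflAux.proj_dot hs hp] at h
        exact dotProduct_self_eq_zero.mp h
    rw [this]
end

section
/- Let G be a real symmetric n×n matrix, γ a real number, and v₁, …, v_k an orthonormal family of vectors in ℝⁿ. Define, for each 1 ≤ i ≤ k, the vector w_i = −γ(I − v_i v_iᵀ − 2∑_{j=1}^{i−1} v_j v_jᵀ) G v_i, and set R = I − 2∑_{j=1}^{k} v_j v_jᵀ. Then −2∑_{i=1}^{k} (w_i v_iᵀ + v_i w_iᵀ) = γ(G − RGR). (This identity shows that the eigenvector formulation of high-index saddle dynamics, dv_i/dt = −γ(I − v_i v_iᵀ − 2∑_{j<i} v_j v_jᵀ)Gv_i, induces the reflection-matrix dynamics dR/dt = γ(G − RGR) for R = I − 2∑_j v_j v_jᵀ.) -/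
open Matrix

theorem double_sum_split {k : ℕ} {M : Type*} [AddCommMonoid M] (f : Fin k → Fin k → M) :
    ∑ i, ∑ j, f i j =
      ∑ i, f i i + ∑ i, ∑ j ∈ Finset.Iio i, f j i + ∑ i, ∑ j ∈ Finset.Iio i, f i j := by
  have h1 : ∑ i, ∑ j ∈ Finset.Iio i, f j i = ∑ i, ∑ j ∈ Finset.Ioi i, f i j := by
    apply Finset.sum_comm'
    simp
  rw [h1, ← Finset.sum_add_distrib, ← Finset.sum_add_distrib]
  refine Finset.sum_congr rfl fun i _ => ?_
  have h2 : (Finset.univ : Finset (Fin k)) = insert i (Finset.Ioi i ∪ Finset.Iio i) := by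
    ext j
    simp only [Finset.mem_univ, Finset.mem_insert, Finset.mem_union, Finset.mem_Ioi,
      Finset.mem_Iio, true_iff]
    rcases lt_trichotomy i j with h | h | h <;> simp [h]
  rw [h2, Finset.sum_insert (by simp), Finset.sum_union, add_assoc]
  rw [Finset.disjoint_left]
  intro a ha hb
  simp only [Finset.mem_Ioi, Finset.mem_Iio] at ha hb
  exact absurd ha (not_lt.mpr hb.le)

/-- Let `G` be a real symmetric `n × n` matrix, `γ ∈ ℝ`, and
`v₁, …, v_k` an orthonormal family in `ℝⁿ`. With
`wᵢ = −γ (I − vᵢvᵢᵀ − 2∑_{j<i} vⱼvⱼᵀ) G vᵢ` and `R = I − 2∑_{j} vⱼvⱼᵀ`, one has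
`−2 ∑ᵢ (wᵢ vᵢᵀ + vᵢ wᵢᵀ) = γ (G − RGR)`: the eigenvector formulation of high-index
saddle dynamics induces the reflection-matrix dynamics `dR/dt = γ(G − RGR)`. -/
theorem stmt5 {n k : ℕ} (G : Matrix (Fin n) (Fin n) ℝ) (hG : G.IsSymm) (γ : ℝ)
    (v : Fin k → (Fin n → ℝ))
    (hv : ∀ i j, v i ⬝ᵥ v j = if i = j then (1 : ℝ) else 0)
    (w : Fin k → (Fin n → ℝ))
    (hw : ∀ i, w i = (-γ) •
      ((1 - vecMulVec (v i) (v i) -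
          (2 : ℝ) • ∑ j ∈ Finset.Iio i, vecMulVec (v j) (v j)) *ᵥ (G *ᵥ v i)))
    (R : Matrix (Fin n) (Fin n) ℝ)
    (hR : R = 1 - (2 : ℝ) • ∑ j, vecMulVec (v j) (v j)) :
    (-2 : ℝ) • ∑ i, (vecMulVec (w i) (v i) + vecMulVec (v i) (w i)) =
      γ • (G - R * G * R) := by
  have hT : ∀ i, (vecMulVec (v i) (v i))ᵀ = vecMulVec (v i) (v i) := fun i =>
    transpose_vecMulVec _ _
  have key : ∀ i, vecMulVec (w i) (v i) = (-γ) •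
      ((1 - vecMulVec (v i) (v i) -
          (2 : ℝ) • ∑ j ∈ Finset.Iio i, vecMulVec (v j) (v j)) * G * vecMulVec (v i) (v i)) := by
    intro i
    rw [hw, smul_vecMulVec, mulVec_mulVec, ← mul_vecMulVec]
  have key2 : ∀ i, vecMulVec (v i) (w i) = (-γ) •
      (vecMulVec (v i) (v i) * G * (1 - vecMulVec (v i) (v i) -
          (2 : ℝ) • ∑ j ∈ Finset.Iio i, vecMulVec (v j) (v j))) := by
    intro i
    rw [← transpose_vecMulVec, key]
    simp only [transpose_smul, transpose_mul, transpose_sub, transpose_sum, hT, hG.eq,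
      transpose_one, Matrix.mul_assoc]
  simp only [key, key2]
  clear key key2 hw hv
  generalize hP : (fun i => vecMulVec (v i) (v i)) = P at *
  have hP' : ∀ i, vecMulVec (v i) (v i) = P i := fun i => by rw [← hP]
  simp only [hP'] at *
  have hS : (∑ i, P i) * G * (∑ i, P i) = ∑ i, P i * G * P i
      + ∑ i, ∑ j ∈ Finset.Iio i, P j * G * P i + ∑ i, ∑ j ∈ Finset.Iio i, P i * G * P j := by
    rw [← double_sum_split (fun i j => P i * G * P j)]
    simp only [Finset.sum_mul, Finset.mul_sum]
    exact Finset.sum_comm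
  have hR2 : G - R * G * R = (2 : ℝ) • ((∑ i, P i) * G) + (2 : ℝ) • (G * ∑ i, P i)
      - (4 : ℝ) • ((∑ i, P i) * G * (∑ i, P i)) := by
    rw [hR]
    simp only [sub_mul, mul_sub, one_mul, mul_one, smul_mul_assoc, mul_smul_comm, smul_smul]
    module
  rw [hR2, hS]
  simp only [sub_mul, mul_sub, one_mul, mul_one, smul_mul_assoc, mul_smul_comm, Finset.sum_mul,
    Finset.mul_sum, Finset.sum_add_distrib, Finset.sum_sub_distrib, ← Finset.smul_sum]
  module
end

section
/- Let R be a real symmetric n×n matrix with R² = I and dim ker(R + I) = k. Then the real vector space {A ∈ Sym_n : AR + RA = 0} of symmetric matrices anticommuting with R has dimension k(n − k). (This is the dimension of the tangent space T_R𝓡_k of the reflection manifold 𝓡_k at R.) -/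
open Matrix

/-- Let `R` be a real symmetric `n × n` matrix with `R² = I` and
`dim ker(R + I) = k`. Then the real vector space
`{A ∈ Sym_n : AR + RA = 0}` of symmetric matrices anticommuting with `R` — expressed
here as the intersection of the kernel of `A ↦ Aᵀ − A` (symmetry) with the kernel of
`A ↦ AR + RA` — has dimension `k(n − k)`. This is the dimension of the tangent space
`T_R𝓡_k` of the reflection manifold at `R`. -/
theorem stmt7 {n k : ℕ} (R : Matrix (Fin n) (Fin n) ℝ)
    (hR : R.IsSymm) (hR2 : R * R = 1)
    (hker : Module.finrank ℝ (LinearMap.ker (R + 1).mulVecLin) = k) :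
    Module.finrank ℝ
      ↥(LinearMap.ker
          ((Matrix.transposeLinearEquiv (Fin n) (Fin n) ℝ ℝ).toLinearMap -
            LinearMap.id) ⊓
        LinearMap.ker (LinearMap.mulRight ℝ R + LinearMap.mulLeft ℝ R)) =
      k * (n - k) := by
  set T := (R + 1).mulVecLin with hT
  have hRU : ∀ u ∈ LinearMap.range T, R *ᵥ u = u := by
    rintro _ ⟨v, rfl⟩
    simp only [hT, Matrix.mulVecLin_apply, Matrix.mulVec_mulVec, Matrix.mul_add, hR2, mul_one]
    rw [add_comm]
  have hRW : ∀ w ∈ LinearMap.ker T, R *ᵥ w = -w := by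
    intro w hw
    have h : (R + 1) *ᵥ w = 0 := hw
    rw [Matrix.add_mulVec, Matrix.one_mulVec] at h
    exact eq_neg_of_add_eq_zero_left h
  have hrank : Module.finrank ℝ (LinearMap.range T) = n - k := by
    have h := LinearMap.finrank_range_add_finrank_ker T
    rw [Module.finrank_fin_fun] at h
    omega
  let m : (LinearMap.range T →ₗ[ℝ] LinearMap.ker T) →ₗ[ℝ] Matrix (Fin n) (Fin n) ℝ :=
    { toFun := fun B => LinearMap.toMatrix'
        ((LinearMap.ker T).subtype ∘ₗ B ∘ₗ ((1 / 2 : ℝ) • T.rangeRestrict))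
      map_add' := by
        intro B C
        rw [← map_add]
        congr 1
      map_smul' := by
        intro c B
        rw [RingHom.id_apply, ← map_smul]
        congr 1 }
  have hm : ∀ B v, m B *ᵥ v = (B ((1 / 2 : ℝ) • T.rangeRestrict v) : Fin n → ℝ) := by
    intro B v
    change (LinearMap.toMatrix'
      ((LinearMap.ker T).subtype ∘ₗ B ∘ₗ ((1 / 2 : ℝ) • T.rangeRestrict))) *ᵥ v = _
    rw [LinearMap.toMatrix'_mulVec]
    rfl
  have hRm : ∀ B, R * m B = - m B := by
    intro B
    apply Matrix.ext_of_mulVec_single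
    intro i
    rw [← Matrix.mulVec_mulVec, Matrix.neg_mulVec, hm]
    exact hRW _ (B _).2
  have hTR : ∀ v, T (R *ᵥ v) = T v := by
    intro v
    simp only [hT, Matrix.mulVecLin_apply, Matrix.mulVec_mulVec, Matrix.add_mul, hR2, one_mul]
    rw [add_comm]
  have hmR : ∀ B, m B * R = m B := by
    intro B
    apply Matrix.ext_of_mulVec_single
    intro i
    rw [← Matrix.mulVec_mulVec, hm, hm]
    have : T.rangeRestrict (R *ᵥ Pi.single i 1) = T.rangeRestrict (Pi.single i 1) :=
      Subtype.ext (hTR _)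
    rw [this]
  have hmt : ∀ B, (m B)ᵀ * R = - (m B)ᵀ := by
    intro B
    have := congrArg Matrix.transpose (hRm B)
    rwa [Matrix.transpose_mul, hR.eq, Matrix.transpose_neg] at this
  have hRmt : ∀ B, R * (m B)ᵀ = (m B)ᵀ := by
    intro B
    have := congrArg Matrix.transpose (hmR B)
    rwa [Matrix.transpose_mul, hR.eq] at this
  let h : (LinearMap.range T →ₗ[ℝ] LinearMap.ker T) →ₗ[ℝ] Matrix (Fin n) (Fin n) ℝ :=
    m + (Matrix.transposeLinearEquiv (Fin n) (Fin n) ℝ ℝ).toLinearMap ∘ₗ m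
  have hh : ∀ B, h B = m B + (m B)ᵀ := fun B => rfl
  have hU : ∀ B (u : LinearMap.range T), h B *ᵥ (u : Fin n → ℝ) = B u := by
    intro B u
    have hu := hRU u u.2
    have h1 : (m B)ᵀ *ᵥ (u : Fin n → ℝ) = 0 := by
      have h2 : (m B)ᵀ *ᵥ (u : Fin n → ℝ) = - ((m B)ᵀ *ᵥ (u : Fin n → ℝ)) := by
        conv_lhs => rw [← hu, Matrix.mulVec_mulVec, hmt, Matrix.neg_mulVec]
      exact self_eq_neg.mp h2
    rw [hh, Matrix.add_mulVec, h1, add_zero, hm]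
    congr 2
    apply Subtype.ext
    change (1 / 2 : ℝ) • ((R + 1) *ᵥ (u : Fin n → ℝ)) = u
    rw [Matrix.add_mulVec, Matrix.one_mulVec, hu, ← two_smul ℝ, smul_smul]
    norm_num
  have hinj : Function.Injective h := by
    intro B C hBC
    ext1 u
    apply Subtype.ext
    rw [← hU, ← hU, hBC]
  have hrange : LinearMap.range h = (LinearMap.ker
          ((Matrix.transposeLinearEquiv (Fin n) (Fin n) ℝ ℝ).toLinearMap -
            LinearMap.id) ⊓
        LinearMap.ker (LinearMap.mulRight ℝ R + LinearMap.mulLeft ℝ R)) := by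
    apply le_antisymm
    · rintro _ ⟨B, rfl⟩
      refine ⟨?_, ?_⟩
      · change (h B)ᵀ - h B = 0
        rw [hh, Matrix.transpose_add, Matrix.transpose_transpose, add_comm, sub_self]
      · change h B * R + R * h B = 0
        rw [hh, add_mul, mul_add, hmR, hRm, hmt, hRmt]
        abel
    · rintro A ⟨hA1, hA2⟩
      have hAt : Aᵀ = A := sub_eq_zero.mp hA1
      have hAR : A * R + R * A = 0 := hA2
      have hmem : ∀ u : LinearMap.range T, A *ᵥ (u : Fin n → ℝ) ∈ LinearMap.ker T := by
        intro u
        change (R + 1) *ᵥ (A *ᵥ (u : Fin n → ℝ)) = 0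
        rw [Matrix.add_mulVec, Matrix.one_mulVec]
        nth_rewrite 2 [← hRU u u.2]
        rw [Matrix.mulVec_mulVec, Matrix.mulVec_mulVec, ← Matrix.add_mulVec, add_comm, hAR,
          Matrix.zero_mulVec]
      let B : LinearMap.range T →ₗ[ℝ] LinearMap.ker T :=
        LinearMap.codRestrict _ (A.mulVecLin ∘ₗ (LinearMap.range T).subtype) hmem
      have hmB : m B = (1 / 2 : ℝ) • (A * (R + 1)) := by
        apply Matrix.ext_of_mulVec_single
        intro i
        rw [hm]
        change A *ᵥ ((1 / 2 : ℝ) • ((R + 1) *ᵥ _)) = _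
        rw [Matrix.mulVec_smul, Matrix.mulVec_mulVec, Matrix.smul_mulVec]
      refine ⟨B, ?_⟩
      rw [hh, hmB, Matrix.transpose_smul, Matrix.transpose_mul, Matrix.transpose_add, hAt, hR.eq,
        Matrix.transpose_one, ← smul_add, mul_add, add_mul, mul_one, one_mul]
      have : A * R + A + (R * A + A) = (2 : ℝ) • A := by
        rw [two_smul, add_add_add_comm, hAR, zero_add]
      rw [this, smul_smul]
      norm_num
  rw [← hrange, LinearMap.finrank_range_of_inj hinj, Module.finrank_linearMap, hrank, hker,
    mul_comm]
end

section
/- Let G be a real symmetric n×n matrix and let a, b ≥ 0 be such that a‖v‖² ≤ ⟨v, |G| v⟩ ≤ b‖v‖² for every v ∈ ℝⁿ (equivalently, every eigenvalue λ of G satisfies a ≤ |λ| ≤ b). Let α ∈ [1/2, 1] and s ∈ {+1, −1}, and set A = α|G| + (1−α)sG. Then A is symmetric and satisfies (2α−1)a‖v‖² ≤ ⟨v, A v⟩ ≤ b‖v‖² for every v ∈ ℝⁿ; consequently, for every η > 0, the spectral norm satisfies ‖I − ηA‖₂ ≤ max(|1 − ηb|, |1 − η(2α−1)a|). -/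
open Matrix

/-- Symmetric matrices are self-adjoint for the dot product. -/
theorem symm_dot {n : ℕ} {B : Matrix (Fin n) (Fin n) ℝ} (hB : B.IsSymm) (x y : Fin n → ℝ) :
    x ⬝ᵥ (B *ᵥ y) = (B *ᵥ x) ⬝ᵥ y := by
  rw [Matrix.dotProduct_mulVec, ← Matrix.mulVec_transpose, hB.eq]

/-- If `P ⪰ 0` and `P² = H²` with `H` symmetric, then `H ⪯ P`. -/
theorem le_of_sq_eq {n : ℕ} {P H : Matrix (Fin n) (Fin n) ℝ} (hP : P.PosSemidef)
    (hH : H.IsSymm) (h2 : P * P = H * H) (v : Fin n → ℝ) :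
    v ⬝ᵥ (H *ᵥ v) ≤ v ⬝ᵥ (P *ᵥ v) := by
  have hPs : P.IsSymm := by
    have := hP.isHermitian
    rwa [Matrix.IsHermitian, Matrix.conjTranspose_eq_transpose_of_trivial] at this
  have hD : (P - H).IsHermitian := by
    rw [Matrix.IsHermitian, Matrix.conjTranspose_eq_transpose_of_trivial,
      Matrix.transpose_sub, hPs.eq, hH.eq]
  have hpos : (P - H).PosSemidef := by
    rw [hD.posSemidef_iff_eigenvalues_nonneg]
    intro i
    change (0 : ℝ) ≤ hD.eigenvalues i
    by_contra! hneg
    have he := hD.mulVec_eigenvectorBasis i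
    set μ := hD.eigenvalues i
    set w : Fin n → ℝ := (hD.eigenvectorBasis i).ofLp with hw
    have hw1 : w ⬝ᵥ w = 1 := by
      have h1 := hD.eigenvectorBasis.orthonormal.1 i
      have h2 := EuclideanSpace.real_norm_sq_eq (hD.eigenvectorBasis i)
      rw [h1] at h2
      simp only [dotProduct, hw]
      rw [← one_pow 2, h2]
      exact Finset.sum_congr rfl fun j _ => (sq _).symm
    have hHw : H *ᵥ w = P *ᵥ w - μ • w := by
      rw [← he, Matrix.sub_mulVec]; abel
    have hn : (P *ᵥ w) ⬝ᵥ (P *ᵥ w) = (H *ᵥ w) ⬝ᵥ (H *ᵥ w) := by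
      rw [← symm_dot hPs, ← symm_dot hH, Matrix.mulVec_mulVec, Matrix.mulVec_mulVec, h2]
    have hp : 0 ≤ w ⬝ᵥ (P *ᵥ w) := by
      simpa using hP.dotProduct_mulVec_nonneg w
    rw [hHw] at hn
    simp only [sub_dotProduct, dotProduct_sub, smul_dotProduct, dotProduct_smul, smul_eq_mul,
      hw1, dotProduct_comm (P *ᵥ w) w] at hn
    nlinarith
  have := hpos.dotProduct_mulVec_nonneg v
  simp only [star_trivial, Matrix.sub_mulVec, dotProduct_sub] at this
  linarith

/-- A symmetric matrix with `|⟨v, Bv⟩| ≤ c‖v‖²` has spectral norm at most `c`. -/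
theorem norm_le_of_quad {n : ℕ} {B : Matrix (Fin n) (Fin n) ℝ} (hB : B.IsSymm) (c : ℝ)
    (hc : 0 ≤ c) (h : ∀ v : Fin n → ℝ, |v ⬝ᵥ (B *ᵥ v)| ≤ c * (v ⬝ᵥ v)) :
    ‖LinearMap.toContinuousLinearMap (Matrix.toEuclideanLin B)‖ ≤ c := by
  have key : ∀ x y : Fin n → ℝ,
      4 * ((B *ᵥ x) ⬝ᵥ y) ≤ c * (2 * (x ⬝ᵥ x) + 2 * (y ⬝ᵥ y)) := by
    intro x y
    have h1 := (abs_le.1 (h (x + y))).2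
    have h2 := (abs_le.1 (h (x - y))).1
    have h3 := symm_dot hB x y
    have h4 := dotProduct_comm y (B *ᵥ x)
    simp only [Matrix.mulVec_add, Matrix.mulVec_sub, add_dotProduct, dotProduct_add,
      sub_dotProduct, dotProduct_sub] at h1 h2
    rw [dotProduct_comm y x] at h1 h2
    linarith
  have nn : ∀ x : Fin n → ℝ, 0 ≤ x ⬝ᵥ x := fun x =>
    Finset.sum_nonneg fun i _ => mul_self_nonneg (x i)
  have main : ∀ v : Fin n → ℝ, (B *ᵥ v) ⬝ᵥ (B *ᵥ v) ≤ c ^ 2 * (v ⬝ᵥ v) := by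
    intro v
    rcases hc.eq_or_lt with h0 | hpos
    · have := key v (B *ᵥ v)
      rw [← h0] at this ⊢
      linarith
    · have := key (c • v) (B *ᵥ v)
      simp only [Matrix.mulVec_smul, smul_dotProduct, dotProduct_smul, smul_eq_mul] at this
      refine le_of_mul_le_mul_left ?_ hpos
      nlinarith
  refine ContinuousLinearMap.opNorm_le_bound _ hc fun v => ?_
  refine abs_le_of_sq_le_sq' ?_ (by positivity) |>.2
  rw [mul_pow, EuclideanSpace.real_norm_sq_eq, EuclideanSpace.real_norm_sq_eq]
  have := main v.ofLp
  simp only [dotProduct, ← sq] at this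
  exact this

/-- Let `G` be real symmetric and `|G|` its positive semidefinite
absolute value (`|G| ⪰ 0`, `|G|² = G²`), with `a‖v‖² ≤ ⟨v, |G|v⟩ ≤ b‖v‖²` for all `v`
(`a, b ≥ 0`). For `α ∈ [1/2, 1]`, `s ∈ {±1}` and `A = α|G| + (1−α)sG`: `A` is
symmetric, `(2α−1)a‖v‖² ≤ ⟨v, Av⟩ ≤ b‖v‖²` for all `v`, and for every `η > 0` the
spectral norm satisfies `‖I − ηA‖₂ ≤ max(|1 − ηb|, |1 − η(2α−1)a|)` (the spectral norm
being expressed as the operator norm of the induced map on Euclidean space). -/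
theorem stmt10 {n : ℕ} (G : Matrix (Fin n) (Fin n) ℝ) (hG : G.IsSymm)
    (absG : Matrix (Fin n) (Fin n) ℝ)
    (habs : absG.PosSemidef) (habs2 : absG * absG = G * G)
    (a b : ℝ) (ha : 0 ≤ a) (hb : 0 ≤ b)
    (hbound : ∀ v : Fin n → ℝ,
      a * (v ⬝ᵥ v) ≤ v ⬝ᵥ (absG *ᵥ v) ∧ v ⬝ᵥ (absG *ᵥ v) ≤ b * (v ⬝ᵥ v))
    (α : ℝ) (hα : α ∈ Set.Icc (1 / 2 : ℝ) 1) (s : ℝ) (hs : s = 1 ∨ s = -1) :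
    (α • absG + ((1 - α) * s) • G).IsSymm ∧
    (∀ v : Fin n → ℝ,
      (2 * α - 1) * a * (v ⬝ᵥ v) ≤ v ⬝ᵥ ((α • absG + ((1 - α) * s) • G) *ᵥ v) ∧
      v ⬝ᵥ ((α • absG + ((1 - α) * s) • G) *ᵥ v) ≤ b * (v ⬝ᵥ v)) ∧
    (∀ η : ℝ, 0 < η →
      ‖LinearMap.toContinuousLinearMap (Matrix.toEuclideanLin
          ((1 : Matrix (Fin n) (Fin n) ℝ) - η • (α • absG + ((1 - α) * s) • G)))‖ ≤
        max |1 - η * b| |1 - η * ((2 * α - 1) * a)|) := by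
  have hPs : absG.IsSymm := by
    have := habs.isHermitian
    rwa [Matrix.IsHermitian, Matrix.conjTranspose_eq_transpose_of_trivial] at this
  obtain ⟨hα1, hα2⟩ := hα
  have hA : (α • absG + ((1 - α) * s) • G).IsSymm := (hPs.smul _).add (hG.smul _)
  have hq : ∀ v : Fin n → ℝ,
      (2 * α - 1) * a * (v ⬝ᵥ v) ≤ v ⬝ᵥ ((α • absG + ((1 - α) * s) • G) *ᵥ v) ∧
      v ⬝ᵥ ((α • absG + ((1 - α) * s) • G) *ᵥ v) ≤ b * (v ⬝ᵥ v) := by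
    intro v
    obtain ⟨h1, h2⟩ := hbound v
    have g1 := le_of_sq_eq habs hG habs2 v
    have g2 := le_of_sq_eq habs hG.neg (by rw [habs2, neg_mul_neg]) v
    simp only [Matrix.neg_mulVec, dotProduct_neg] at g2
    simp only [Matrix.add_mulVec, Matrix.smul_mulVec, dotProduct_add, dotProduct_smul,
      smul_eq_mul]
    generalize v ⬝ᵥ (G *ᵥ v) = g at *
    generalize v ⬝ᵥ (absG *ᵥ v) = p at *
    have e1 : 0 ≤ (1 - α) * (p - g) := mul_nonneg (by linarith) (by linarith)
    have e2 : 0 ≤ (1 - α) * (p + g) := mul_nonneg (by linarith) (by linarith)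
    have e3 : 0 ≤ (2 * α - 1) * (p - a * (v ⬝ᵥ v)) := mul_nonneg (by linarith) (by linarith)
    rcases hs with rfl | rfl <;> constructor <;> linarith
  refine ⟨hA, hq, fun η hη => ?_⟩
  refine norm_le_of_quad (Matrix.isSymm_one.sub (hA.smul η)) _
    (le_max_of_le_left (abs_nonneg _)) fun v => ?_
  obtain ⟨h1, h2⟩ := hq v
  have nn : 0 ≤ v ⬝ᵥ v := Finset.sum_nonneg fun i _ => mul_self_nonneg (v i)
  rw [Matrix.sub_mulVec, Matrix.one_mulVec, Matrix.smul_mulVec, dotProduct_sub,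
    dotProduct_smul, smul_eq_mul]
  generalize v ⬝ᵥ ((α • absG + ((1 - α) * s) • G) *ᵥ v) = q at *
  have k1 := mul_le_mul_of_nonneg_left h1 hη.le
  have k2 := mul_le_mul_of_nonneg_left h2 hη.le
  have m1 := mul_le_mul_of_nonneg_right
    ((neg_le_neg (le_max_left |1 - η * b| |1 - η * ((2 * α - 1) * a)|)).trans
      (neg_abs_le _)) nn
  have m2 := mul_le_mul_of_nonneg_right
    ((le_abs_self _).trans (le_max_right |1 - η * b| |1 - η * ((2 * α - 1) * a)|)) nn
  rw [abs_le]
  constructor <;> linarith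
end

section
/- Let E : ℝⁿ → ℝ be twice continuously differentiable with gradient ∇E and Hessian matrix G(x), let x* ∈ ℝⁿ satisfy ∇E(x*) = 0, and suppose there exist δ > 0 and M > 0 such that ‖G(x) − G(y)‖₂ ≤ M‖x − y‖ for all x, y in the open ball B(x*, δ). Let H be any real n×n matrix with spectral norm ‖H‖₂ ≤ 1, let η > 0, let x ∈ B(x*, δ), and set x⁺ = x − ηH∇E(x). Then ‖x⁺ − x*‖ ≤ ‖I − ηHG(x)‖₂ · ‖x − x*‖ + (ηM/2) · ‖x − x*‖². (This is the one-step error estimate for the discretized improved high-index saddle dynamics.) -/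
open Matrix

theorem taylor_aux {V : Type*} [NormedAddCommGroup V] [NormedSpace ℝ V]
    (g : V → V) (A : V → V →L[ℝ] V) (hg : ∀ y, HasFDerivAt g (A y) y)
    (c : V) (δ M : ℝ)
    (hLip : ∀ x ∈ Metric.ball c δ, ∀ y ∈ Metric.ball c δ, ‖A x - A y‖ ≤ M * ‖x - y‖)
    (x y : V) (hx : x ∈ Metric.ball c δ) (hy : y ∈ Metric.ball c δ) :
    ‖g y - g x - A x (y - x)‖ ≤ M / 2 * ‖y - x‖ ^ 2 := by
  set v := y - x with hv
  have hd : ∀ t : ℝ, HasDerivAt (fun t : ℝ => g (x + t • v) - g x - t • A x v)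
      (A (x + t • v) v - A x v) t := by
    intro t
    have h1 : HasDerivAt (fun t : ℝ => x + t • v) v t := by
      simpa using ((hasDerivAt_id t).smul_const v).const_add x
    have h2 : HasDerivAt (fun t : ℝ => t • A x v) (A x v) t := by
      simpa using (hasDerivAt_id t).smul_const (A x v)
    exact (((hg (x + t • v)).comp_hasDerivAt t h1).sub_const (g x)).sub h2
  have hB : ∀ t : ℝ, HasDerivAt (fun t : ℝ => M / 2 * ‖v‖ ^ 2 * t ^ 2)
      (M * ‖v‖ ^ 2 * t) t := by
    intro t
    have := (hasDerivAt_pow 2 t).const_mul (M / 2 * ‖v‖ ^ 2)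
    refine this.congr_deriv ?_
    norm_num
    ring
  have key := image_norm_le_of_norm_deriv_right_le_deriv_boundary
    (a := (0 : ℝ)) (b := 1)
    (f := fun t : ℝ => g (x + t • v) - g x - t • A x v)
    (f' := fun t => A (x + t • v) v - A x v)
    (B := fun t : ℝ => M / 2 * ‖v‖ ^ 2 * t ^ 2) (B' := fun t => M * ‖v‖ ^ 2 * t)
    (fun t _ => (hd t).continuousAt.continuousWithinAt)
    (fun t _ => (hd t).hasDerivWithinAt) (by simp) hB
    (by
      intro t ht
      have hmem : x + t • v ∈ Metric.ball c δ :=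
        (convex_ball c δ).add_smul_sub_mem hx hy ⟨ht.1, ht.2.le⟩
      have h1 := hLip _ hmem x hx
      have h2 : ‖(A (x + t • v) - A x) v‖ ≤ ‖A (x + t • v) - A x‖ * ‖v‖ :=
        ContinuousLinearMap.le_opNorm _ _
      have h3 : ‖x + t • v - x‖ = t * ‖v‖ := by
        rw [add_sub_cancel_left, norm_smul, Real.norm_of_nonneg ht.1]
      rw [h3] at h1
      calc _ ≤ ‖A (x + t • v) - A x‖ * ‖v‖ := h2
        _ ≤ (M * (t * ‖v‖)) * ‖v‖ := by gcongr
        _ = _ := by ring)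
  have := key (x := 1) ⟨zero_le_one, le_rfl⟩
  simpa [hv] using this

/-- One-step error estimate for the discretized iHiSD. `E : ℝⁿ → ℝ`
is C² with gradient `∇E` and Hessian matrix `G(x)` (the derivative of the gradient
map), `∇E(x*) = 0`, and `G` is `M`-Lipschitz in spectral norm on the ball `B(x*, δ)`.
If `‖H‖₂ ≤ 1`, `η > 0`, `x ∈ B(x*, δ)` and `x⁺ = x − ηH∇E(x)`, then
`‖x⁺ − x*‖ ≤ ‖I − ηHG(x)‖₂ ‖x − x*‖ + (ηM/2) ‖x − x*‖²`. Spectral norms of matrices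
are expressed as operator norms of the induced maps on Euclidean space. -/
theorem stmt11 {n : ℕ} (E : EuclideanSpace ℝ (Fin n) → ℝ) (hE : ContDiff ℝ 2 E)
    (G : EuclideanSpace ℝ (Fin n) → Matrix (Fin n) (Fin n) ℝ)
    (hHess : ∀ y, HasFDerivAt (fun z => gradient E z)
      (LinearMap.toContinuousLinearMap (Matrix.toEuclideanLin (G y))) y)
    (xstar : EuclideanSpace ℝ (Fin n)) (hcrit : gradient E xstar = 0)
    (δ M : ℝ) (hδ : 0 < δ) (hM : 0 < M)
    (hLip : ∀ x ∈ Metric.ball xstar δ, ∀ y ∈ Metric.ball xstar δ,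
      ‖LinearMap.toContinuousLinearMap (Matrix.toEuclideanLin (G x - G y))‖ ≤
        M * ‖x - y‖)
    (H : Matrix (Fin n) (Fin n) ℝ)
    (hH : ‖LinearMap.toContinuousLinearMap (Matrix.toEuclideanLin H)‖ ≤ 1)
    (η : ℝ) (hη : 0 < η)
    (x : EuclideanSpace ℝ (Fin n)) (hx : x ∈ Metric.ball xstar δ) :
    ‖(x - η • Matrix.toEuclideanLin H (gradient E x)) - xstar‖ ≤
      ‖LinearMap.toContinuousLinearMap (Matrix.toEuclideanLin
          ((1 : Matrix (Fin n) (Fin n) ℝ) - η • (H * G x)))‖ * ‖x - xstar‖ +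
        (η * M / 2) * ‖x - xstar‖ ^ 2 := by
  have hT := taylor_aux (fun z => gradient E z)
    (fun y => LinearMap.toContinuousLinearMap (Matrix.toEuclideanLin (G y))) hHess xstar δ M
    (by
      intro a ha b hb
      have := hLip a ha b hb
      rwa [map_sub, map_sub] at this)
    x xstar hx (Metric.mem_ball_self hδ)
  simp only [hcrit, LinearMap.coe_toContinuousLinearMap'] at hT
  rw [norm_sub_rev xstar x] at hT
  set r := 0 - gradient E x - Matrix.toEuclideanLin (G x) (xstar - x) with hr
  have hmul : ∀ w, Matrix.toEuclideanLin (H * G x) w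
      = Matrix.toEuclideanLin H (Matrix.toEuclideanLin (G x) w) := by
    intro w
    simp [Matrix.toLpLin_apply, Matrix.mulVec_mulVec]
  have hone : ∀ w : EuclideanSpace ℝ (Fin n),
      Matrix.toEuclideanLin (1 : Matrix (Fin n) (Fin n) ℝ) w = w := by
    intro w
    simp
  have hdec : (x - η • Matrix.toEuclideanLin H (gradient E x)) - xstar
      = LinearMap.toContinuousLinearMap (Matrix.toEuclideanLin
          ((1 : Matrix (Fin n) (Fin n) ℝ) - η • (H * G x))) (x - xstar)
        + η • LinearMap.toContinuousLinearMap (Matrix.toEuclideanLin H) r := by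
    rw [LinearMap.coe_toContinuousLinearMap', LinearMap.coe_toContinuousLinearMap',
      map_sub Matrix.toEuclideanLin, map_smul Matrix.toEuclideanLin, LinearMap.sub_apply,
      LinearMap.smul_apply, hmul, hone]
    simp only [hr, map_sub, map_zero]
    module
  have h1 := ContinuousLinearMap.le_opNorm (LinearMap.toContinuousLinearMap
    (Matrix.toEuclideanLin ((1 : Matrix (Fin n) (Fin n) ℝ) - η • (H * G x)))) (x - xstar)
  have h2 : ‖LinearMap.toContinuousLinearMap (Matrix.toEuclideanLin H) r‖ ≤ 1 * ‖r‖ :=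
    ContinuousLinearMap.le_of_opNorm_le _ hH r
  rw [hdec]
  refine (norm_add_le _ _).trans (add_le_add h1 ?_)
  rw [norm_smul, Real.norm_of_nonneg hη.le]
  calc _ ≤ η * (M / 2 * ‖x - xstar‖ ^ 2) := by
        gcongr
        linarith
    _ = _ := by ring
end

section
/- Let (r_m)_{m ≥ m₀} be a sequence of nonnegative real numbers, and let q and c be constants with 0 < q ≤ 1 and c > 0. Suppose r_{m+1} ≤ (1 − q) r_m + c r_m² for every m ≥ m₀, and r_{m₀} < q/c. Then for every m ≥ m₀, r_m ≤ min{ r_{m₀}, (1+q)^{−(m−m₀)} · q r_{m₀} / (q − c r_{m₀}) }. In particular, r_m converges to 0 at the linear rate 1/(1+q). -/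
/-- Recursion lemma for the linear convergence of the discretized
iHiSD. If a nonnegative real sequence satisfies `r_{m+1} ≤ (1−q)r_m + c r_m²` for all
`m ≥ m₀`, with `0 < q ≤ 1`, `c > 0` and `r_{m₀} < q/c`, then for every `m ≥ m₀`,
`r_m ≤ min(r_{m₀}, (1+q)^{−(m−m₀)} q r_{m₀} / (q − c r_{m₀}))`; in particular `r_m → 0`
at the linear rate `1/(1+q)`. -/
theorem stmt12 (r : ℕ → ℝ) (m₀ : ℕ) (q c : ℝ)
    (hq : 0 < q) (hq1 : q ≤ 1) (hc : 0 < c)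
    (hpos : ∀ m, m₀ ≤ m → 0 ≤ r m)
    (hrec : ∀ m, m₀ ≤ m → r (m + 1) ≤ (1 - q) * r m + c * r m ^ 2)
    (hinit : r m₀ < q / c) :
    ∀ m, m₀ ≤ m →
      r m ≤ min (r m₀) (((1 + q)⁻¹) ^ (m - m₀) * (q * r m₀) / (q - c * r m₀)) := by
  have h0 : 0 ≤ r m₀ := hpos m₀ le_rfl
  have hD : 0 < q - c * r m₀ := by
    have := (lt_div_iff₀ hc).1 hinit
    linarith
  have key : ∀ k : ℕ, r (m₀ + k) ≤ r m₀ ∧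
      r (m₀ + k) * ((1 + q) ^ k * (q - c * r m₀)) ≤ r m₀ * (q - c * r (m₀ + k)) := by
    intro k
    induction k with
    | zero => simp
    | succ k ih =>
      obtain ⟨h1, h2⟩ := ih
      have hx := hpos (m₀ + k) (by omega)
      have hx' := hrec (m₀ + k) (by omega)
      rw [← add_assoc]
      generalize r (m₀ + k + 1) = y at *
      generalize r (m₀ + k) = x at *
      have hP : 0 < (1 + q) ^ k * (q - c * r m₀) := by positivity
      rw [pow_succ]
      generalize hPe : (1 + q) ^ k * (q - c * r m₀) = P at *
      have hPe' : (1 + q) ^ k * (1 + q) * (q - c * r m₀) = (1 + q) * P := by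
        rw [← hPe]; ring
      rw [hPe']
      have hcx : c * x ≤ c * r m₀ := mul_le_mul_of_nonneg_left h1 hc.le
      have hcx0 : 0 ≤ c * x := by positivity
      obtain ⟨d, hd⟩ : ∃ d, d = q - c * x := ⟨_, rfl⟩
      have hd0 : 0 < d := by linarith
      have hd1 : 0 ≤ 1 - d := by linarith
      have hy : y ≤ x * (1 - d) := by rw [hd]; linarith
      refine ⟨by nlinarith [mul_nonneg hx hd0.le], ?_⟩
      rw [← hd] at h2
      have e1 : y * ((1 + q) * P + c * r m₀) ≤ x * (1 - d) * ((1 + q) * P + c * r m₀) :=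
        mul_le_mul_of_nonneg_right hy (by positivity)
      have e2 : x * P * ((1 - d) * (1 + q)) ≤ r m₀ * d * ((1 - d) * (1 + q)) :=
        mul_le_mul_of_nonneg_right h2 (by positivity)
      have e3 : 0 ≤ r m₀ * d * (d * q) := by positivity
      have e4 : r m₀ * (1 - d) * (c * x) = r m₀ * (1 - d) * (q - d) := by rw [hd]; ring
      linarith
  intro m hm
  obtain ⟨k, rfl⟩ := Nat.exists_eq_add_of_le hm
  obtain ⟨h1, h2⟩ := key k
  refine le_min h1 ?_
  rw [Nat.add_sub_cancel_left, le_div_iff₀ hD, inv_pow, inv_mul_eq_div,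
    le_div_iff₀ (by positivity)]
  have := mul_nonneg h0 (mul_nonneg hc.le (hpos (m₀ + k) (by omega)))
  linarith
end

section
/- Let E : ℝⁿ → ℝ be twice continuously differentiable with gradient ∇E and Hessian matrix G(x). Assume: (i) ∇E(x*) = 0 and there are constants 0 < μ ≤ L with μ‖v‖² ≤ ⟨v, |G(x*)| v⟩ ≤ L‖v‖² for all v ∈ ℝⁿ, where |G(x*)| is the positive semidefinite square root of G(x*)²; (ii) there are δ > 0 and M > 0 with ‖G(x) − G(y)‖₂ ≤ M‖x − y‖ for all x, y in the open ball B(x*, δ); (iii) 0 < ε < 1, s ∈ {+1, −1}, and for every m ≥ m₀ one is given α_m ∈ [(1+ε)/2, 1] and a real symmetric n×n matrix R_m with R_m² = I and R_m G(x_m) = |G(x_m)| (the positive semidefinite square root of G(x_m)²), and the iterates satisfy x_{m+1} = x_m − η_m (α_m R_m + (1 − α_m) s I) ∇E(x_m) with step size η_m = 2/(L + μ(2α_m − 1)); (iv) r_{m₀} := ‖x_{m₀} − x*‖ < min(δ, 2με/(3M)). Then the sequence (‖x_m − x*‖)_{m ≥ m₀} is nonincreasing, and for every m ≥ m₀, ‖x_m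 − x*‖ ≤ ((κ + ε)/(κ + 3ε))^{m − m₀} · r_{m₀} / (1 − (3M/(2με)) r_{m₀}), where κ = L/μ is the condition number. In particular x_m converges to x* at the linear rate (κ + ε)/(κ + 3ε). -/
open Matrix

section aux
variable {V : Type*} [NormedAddCommGroup V] [InnerProductSpace ℝ V] [FiniteDimensional ℝ V]

lemma aux_quad_expand (T : V →ₗ[ℝ] V) (hT : T.IsSymmetric) (v : V) :
    inner ℝ v (T v) = ∑ i, hT.eigenvalues rfl i * (inner ℝ (hT.eigenvectorBasis rfl i) v) ^ 2 := by
  rw [← (hT.eigenvectorBasis rfl).sum_inner_mul_inner v (T v)]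
  refine Finset.sum_congr rfl fun i _ => ?_
  rw [← hT (hT.eigenvectorBasis rfl i) v, hT.apply_eigenvectorBasis, real_inner_comm]
  simp [inner_smul_left]
  ring

lemma aux_norm_expand (v : V) (T : V →ₗ[ℝ] V) (hT : T.IsSymmetric) :
    ‖v‖ ^ 2 = ∑ i, (inner ℝ (hT.eigenvectorBasis rfl i) v) ^ 2 := by
  rw [← real_inner_self_eq_norm_sq, ← (hT.eigenvectorBasis rfl).sum_inner_mul_inner v v]
  refine Finset.sum_congr rfl fun i _ => ?_
  rw [real_inner_comm]; ring

lemma aux_norm_le (T : V →ₗ[ℝ] V) (hT : T.IsSymmetric) (ρ : ℝ) (hρ : 0 ≤ ρ)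
    (h : ∀ v, |inner ℝ v (T v)| ≤ ρ * ‖v‖ ^ 2) (v : V) : ‖T v‖ ≤ ρ * ‖v‖ := by
  have h2 : ‖T v‖ ^ 2 ≤ (ρ * ‖v‖) ^ 2 := by
    rw [mul_pow, aux_norm_expand (T v) T hT, aux_norm_expand v T hT, Finset.mul_sum]
    refine Finset.sum_le_sum fun i _ => ?_
    rw [← hT (hT.eigenvectorBasis rfl i) v, hT.apply_eigenvectorBasis, inner_smul_left, mul_pow]
    have := h (hT.eigenvectorBasis rfl i)
    rw [hT.apply_eigenvectorBasis, inner_smul_right, real_inner_self_eq_norm_sq] at this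
    simp at this
    refine mul_le_mul_of_nonneg_right ?_ (sq_nonneg _)
    exact sq_le_sq' (abs_le.1 this).1 (abs_le.1 this).2
  exact le_of_sq_le_sq h2 (by positivity)

lemma aux_quad_ge (T : V →ₗ[ℝ] V) (hT : T.IsSymmetric) (c : ℝ)
    (hpos : ∀ v, 0 ≤ inner ℝ v (T v)) (h : ∀ v, c * ‖v‖ ≤ ‖T v‖) (v : V) :
    c * ‖v‖ ^ 2 ≤ inner ℝ v (T v) := by
  rw [aux_quad_expand T hT, aux_norm_expand v T hT, Finset.mul_sum]
  refine Finset.sum_le_sum fun i _ => ?_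
  refine mul_le_mul_of_nonneg_right ?_ (sq_nonneg _)
  have h1 := hpos (hT.eigenvectorBasis rfl i)
  have h2 := h (hT.eigenvectorBasis rfl i)
  rw [hT.apply_eigenvectorBasis, inner_smul_right, real_inner_self_eq_norm_sq] at h1
  rw [hT.apply_eigenvectorBasis, norm_smul] at h2
  simp at h1 h2
  rwa [abs_of_nonneg h1] at h2

lemma aux_sq_norm (S T : V →ₗ[ℝ] V) (hS : S.IsSymmetric) (hT : T.IsSymmetric)
    (h : ∀ v, S (S v) = T (T v)) (v : V) : ‖S v‖ = ‖T v‖ := by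
  have : ‖S v‖ ^ 2 = ‖T v‖ ^ 2 := by
    rw [← real_inner_self_eq_norm_sq, ← real_inner_self_eq_norm_sq, hS, hT, h]
  exact (sq_eq_sq₀ (norm_nonneg _) (norm_nonneg _)).1 this

/-- One contraction step at the linear level. -/
lemma aux_contract (G R Gs A : V →ₗ[ℝ] V) (hG : G.IsSymmetric) (hR : R.IsSymmetric)
    (hGs : Gs.IsSymmetric) (hA : A.IsSymmetric) (hAA : ∀ v, A (A v) = Gs (Gs v))
    (hR2 : ∀ v, R (R v) = v) (hB : (R ∘ₗ G).IsSymmetric)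
    (hBpos : ∀ v, 0 ≤ inner ℝ v (R (G v))) 
    (μ L t a s e : ℝ) (hμ : 0 < μ) (hμL : μ ≤ L)
    (hAb : ∀ v, μ * ‖v‖ ^ 2 ≤ inner ℝ v (A v) ∧ inner ℝ v (A v) ≤ L * ‖v‖ ^ 2)
    (ht0 : 0 ≤ t) (ht : t ≤ μ) (hd : ∀ v, ‖G v - Gs v‖ ≤ t * ‖v‖)
    (ha : 1 / 2 ≤ a) (ha1 : a ≤ 1) (hs : s = 1 ∨ s = -1) (d w : V) (hw : ‖w - G d‖ ≤ e) :
    ‖d - (2 / (L + μ * (2 * a - 1))) • (a • R w + ((1 - a) * s) • w)‖ ≤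
      ((L - μ * (2 * a - 1) + 2 * t) * ‖d‖ + 2 * e) / (L + μ * (2 * a - 1)) := by
  have hD : 0 < L + μ * (2 * a - 1) := by nlinarith
  set D := L + μ * (2 * a - 1) with hDdef
  have hRn : ∀ v, ‖R v‖ = ‖v‖ := fun v =>
    aux_sq_norm R LinearMap.id hR (fun _ _ => rfl) (fun v => by simp [hR2]) v
  have hcomm : ∀ v, G (R v) = R (G v) := by
    intro v
    refine ext_inner_right ℝ fun u => ?_
    rw [hG, hR]
    exact (hB v u).symm
  have hBn : ∀ v, ‖R (G v)‖ = ‖G v‖ := fun v => hRn _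
  have hAn : ∀ v, ‖A v‖ = ‖Gs v‖ := aux_sq_norm A Gs hA hGs hAA
  have hAu : ∀ v, ‖A v‖ ≤ L * ‖v‖ := by
    refine aux_norm_le A hA L (by linarith) fun v => ?_
    rw [abs_le]
    have := hAb v
    have := sq_nonneg ‖v‖
    constructor <;> nlinarith
  have hAl : ∀ v, μ * ‖v‖ ≤ ‖A v‖ := by
    intro v
    rcases eq_or_lt_of_le (norm_nonneg v) with h | h
    · rw [← h]; simp
    · have h1 := (hAb v).1
      have h2 := real_inner_le_norm v (A v)
      nlinarith
  have hGu : ∀ v, ‖G v‖ ≤ (L + t) * ‖v‖ := by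
    intro v
    have h1 := hAu v
    rw [hAn] at h1
    have h2 := norm_le_norm_add_norm_sub' (G v) (Gs v)
    linarith [hd v]
  have hGl : ∀ v, (μ - t) * ‖v‖ ≤ ‖G v‖ := by
    intro v
    have h1 := hAl v
    rw [hAn] at h1
    have h2 := norm_le_norm_add_norm_sub' (Gs v) (G v)
    rw [norm_sub_rev] at h2
    linarith [hd v]
  have hBl : ∀ v, (μ - t) * ‖v‖ ^ 2 ≤ inner ℝ v (R (G v)) :=
    aux_quad_ge (R ∘ₗ G) hB (μ - t) hBpos (fun v => by simpa [hBn] using hGl v)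
  have hBu : ∀ v, inner ℝ v (R (G v)) ≤ (L + t) * ‖v‖ ^ 2 := by
    intro v
    have h2 := real_inner_le_norm v (R (G v))
    rw [hBn] at h2
    nlinarith [hGu v, norm_nonneg v]
  have hGB1 : ∀ v, inner ℝ v (G v) ≤ inner ℝ v (R (G v)) := by
    intro v
    have := hBpos (v - R v)
    simp only [map_sub, hcomm, hR2, inner_sub_left, inner_sub_right, hR v] at this
    linarith
  have hGB2 : ∀ v, -inner ℝ v (G v) ≤ inner ℝ v (R (G v)) := by
    intro v
    have := hBpos (v + R v)
    simp only [map_add, hcomm, hR2, inner_add_left, inner_add_right, hR v] at this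
    linarith
  let P : V →ₗ[ℝ] V := a • R + ((1 - a) * s) • LinearMap.id
  have hPn : ∀ v, ‖P v‖ ≤ ‖v‖ := by
    intro v
    have : ‖P v‖ ≤ ‖a • R v‖ + ‖((1 - a) * s) • v‖ := norm_add_le _ _
    rw [norm_smul, norm_smul, hRn, Real.norm_eq_abs, Real.norm_eq_abs, abs_mul,
      abs_of_nonneg (by linarith : 0 ≤ a), abs_of_nonneg (by linarith : 0 ≤ 1 - a)] at this
    have hs1 : |s| = 1 := by rcases hs with rfl | rfl <;> simp
    rw [hs1] at this
    linarith
  let T : V →ₗ[ℝ] V := LinearMap.id - (2 / D) • (P ∘ₗ G)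
  have hTv : ∀ v, T v = v - (2 / D) • (a • R (G v) + ((1 - a) * s) • G v) := fun v => rfl
  have hTs : T.IsSymmetric := by
    intro u v
    have hBuv : inner ℝ (R (G u)) v = inner ℝ u (R (G v)) := hB u v
    rw [hTv, hTv]
    simp only [inner_sub_left, inner_sub_right, inner_add_left, inner_add_right,
      real_inner_smul_left, real_inner_smul_right, hBuv, hG u v]
  have hTn : ‖T d‖ ≤ ((L - μ * (2 * a - 1) + 2 * t) / D) * ‖d‖ := by
    have h2a : 0 ≤ 2 * a - 1 := by linarith
    refine aux_norm_le T hTs _ (div_nonneg (by nlinarith) hD.le) (fun v => ?_) d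
    rw [hTv]
    simp only [inner_sub_right, inner_add_right, real_inner_smul_right,
      real_inner_self_eq_norm_sq]
    have hN := sq_nonneg ‖v‖
    have b1 := hBl v
    have b2 := hBu v
    have b3 := hGB1 v
    have b4 := hGB2 v
    generalize ‖v‖ ^ 2 = N at hN b1 b2 ⊢
    generalize inner ℝ v (R (G v)) = b at *
    generalize inner ℝ v (G v) = g at *
    have q1 : (2 * a - 1) * b ≤ a * b + (1 - a) * s * g := by
      rcases hs with rfl | rfl <;> nlinarith
    have q2 : a * b + (1 - a) * s * g ≤ b := by
      rcases hs with rfl | rfl <;> nlinarith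
    generalize a * b + (1 - a) * s * g = q at *
    have q3 : (2 * a - 1) * ((μ - t) * N) ≤ q :=
      (mul_le_mul_of_nonneg_left b1 h2a).trans q1
    have q4 : (2 * a - 1) * (t * N) ≤ 1 * (t * N) :=
      mul_le_mul_of_nonneg_right (by linarith) (by positivity)
    have e1 : N - 2 / D * q = (D * N - 2 * q) / D := by field_simp
    rw [e1, abs_div, abs_of_pos hD, div_mul_eq_mul_div]
    refine div_le_div_of_nonneg_right ?_ hD.le
    rw [abs_le, hDdef]
    constructor <;> nlinarith
  have hfin : d - (2 / D) • (a • R w + ((1 - a) * s) • w) = T d - (2 / D) • P (w - G d) := by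
    have : a • R w + ((1 - a) * s) • w = P w := rfl
    rw [this, map_sub]
    change _ = (d - (2 / D) • P (G d)) - _
    module
  rw [hfin]
  refine (norm_sub_le _ _).trans ?_
  rw [norm_smul, Real.norm_of_nonneg (by positivity)]
  have h3 : 2 / D * ‖P (w - G d)‖ ≤ 2 / D * e :=
    mul_le_mul_of_nonneg_left ((hPn _).trans hw) (by positivity)
  refine (add_le_add hTn h3).trans (le_of_eq ?_)
  field_simp

end aux

lemma aux_taylor {V : Type*} [NormedAddCommGroup V] [InnerProductSpace ℝ V]
    (g : V → V) (H : V → V →L[ℝ] V) (hg : ∀ y, HasFDerivAt g (H y) y) (x z : V) (M : ℝ)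
    (hL : ∀ t ∈ Set.Icc (0 : ℝ) 1, ‖H (x + t • (z - x)) - H x‖ ≤ M * ‖t • (z - x)‖) :
    ‖g z - g x - H x (z - x)‖ ≤ M / 2 * ‖z - x‖ ^ 2 := by
  have hc : ∀ t : ℝ, HasDerivAt (fun t : ℝ => x + t • (z - x)) (z - x) t := fun t => by
    simpa using ((hasDerivAt_id t).smul_const (z - x)).const_add x
  have hf : ∀ t : ℝ, HasDerivAt (fun t : ℝ => g (x + t • (z - x)) - g x - t • H x (z - x))
      (H (x + t • (z - x)) (z - x) - H x (z - x)) t := fun t => by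
    have h1 := (hg (x + t • (z - x))).comp_hasDerivAt t (hc t)
    have h2 := (hasDerivAt_id t).smul_const (H x (z - x))
    refine ((h1.sub_const (g x)).sub h2).congr_deriv ?_
    simp
  have hB : ∀ t : ℝ, HasDerivAt (fun t : ℝ => M / 2 * ‖z - x‖ ^ 2 * t ^ 2)
      (M * ‖z - x‖ ^ 2 * t) t := fun t => by
    refine ((hasDerivAt_pow 2 t).const_mul (M / 2 * ‖z - x‖ ^ 2)).congr_deriv ?_
    simp; ring
  have := image_norm_le_of_norm_deriv_right_le_deriv_boundary (a := (0 : ℝ)) (b := 1)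
    (fun t _ => (hf t).continuousAt.continuousWithinAt)
    (fun t _ => (hf t).hasDerivWithinAt) (by simp) hB
    (fun t ht => by
      rw [← _root_.sub_apply]
      refine (ContinuousLinearMap.le_opNorm _ _).trans ?_
      have := mul_le_mul_of_nonneg_right (hL t ⟨ht.1, ht.2.le⟩) (norm_nonneg (z - x))
      rw [norm_smul, Real.norm_of_nonneg ht.1] at this
      linarith) (Set.right_mem_Icc.2 zero_le_one)
  simpa using this

set_option maxHeartbeats 2000000 in
/-- Linear convergence of the discretized improved high-index saddle
dynamics (iHiSD). `E : ℝⁿ → ℝ` is C² with gradient `∇E` and Hessian matrix `G(x)` (the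
derivative of the gradient map). Assume: (i) `∇E(x*) = 0` and
`μ‖v‖² ≤ ⟨v, |G(x*)|v⟩ ≤ L‖v‖²` for all `v`, where `|G(x*)|` (here `absG`) is the
positive semidefinite square root of `G(x*)²`; (ii) `G` is `M`-Lipschitz in spectral
norm on `B(x*, δ)`; (iii) `0 < ε < 1`, `s ∈ {±1}`, and for `m ≥ m₀`,
`α_m ∈ [(1+ε)/2, 1]`, `R_m` is symmetric with `R_m² = I` and `R_m G(x_m) = |G(x_m)|`
(expressed by `R_m G(x_m) ⪰ 0` and `(R_m G(x_m))² = G(x_m)²`), and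
`x_{m+1} = x_m − η_m (α_m R_m + (1−α_m)sI)∇E(x_m)` with
`η_m = 2/(L + μ(2α_m − 1))`; (iv) `r_{m₀} = ‖x_{m₀} − x*‖ < min(δ, 2με/(3M))`.
Then `(‖x_m − x*‖)_{m ≥ m₀}` is nonincreasing and for every `m ≥ m₀`,
`‖x_m − x*‖ ≤ ((κ+ε)/(κ+3ε))^{m−m₀} r_{m₀}/(1 − (3M/(2με)) r_{m₀})`, where
`κ = L/μ`. -/
theorem stmt13 {n : ℕ} (E : EuclideanSpace ℝ (Fin n) → ℝ) (hE : ContDiff ℝ 2 E)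
    (G : EuclideanSpace ℝ (Fin n) → Matrix (Fin n) (Fin n) ℝ)
    (hGsymm : ∀ y, (G y).IsSymm)
    (hHess : ∀ y, HasFDerivAt (fun z => gradient E z)
      (LinearMap.toContinuousLinearMap (Matrix.toEuclideanLin (G y))) y)
    (xstar : EuclideanSpace ℝ (Fin n)) (hcrit : gradient E xstar = 0)
    (μ L : ℝ) (hμ : 0 < μ) (hμL : μ ≤ L)
    (absG : Matrix (Fin n) (Fin n) ℝ)
    (habs : absG.PosSemidef) (habs2 : absG * absG = G xstar * G xstar)
    (hbound : ∀ v : Fin n → ℝ,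
      μ * (v ⬝ᵥ v) ≤ v ⬝ᵥ (absG *ᵥ v) ∧ v ⬝ᵥ (absG *ᵥ v) ≤ L * (v ⬝ᵥ v))
    (δ M : ℝ) (hδ : 0 < δ) (hM : 0 < M)
    (hLip : ∀ x ∈ Metric.ball xstar δ, ∀ y ∈ Metric.ball xstar δ,
      ‖LinearMap.toContinuousLinearMap (Matrix.toEuclideanLin (G x - G y))‖ ≤
        M * ‖x - y‖)
    (ε : ℝ) (hε0 : 0 < ε) (hε1 : ε < 1) (s : ℝ) (hs : s = 1 ∨ s = -1)
    (m₀ : ℕ) (α : ℕ → ℝ) (hα : ∀ m, m₀ ≤ m → α m ∈ Set.Icc ((1 + ε) / 2) 1)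
    (R : ℕ → Matrix (Fin n) (Fin n) ℝ)
    (hRsymm : ∀ m, m₀ ≤ m → (R m).IsSymm)
    (hR2 : ∀ m, m₀ ≤ m → R m * R m = 1)
    (x : ℕ → EuclideanSpace ℝ (Fin n))
    (hRG : ∀ m, m₀ ≤ m → (R m * G (x m)).PosSemidef ∧
      (R m * G (x m)) * (R m * G (x m)) = G (x m) * G (x m))
    (η : ℕ → ℝ) (hη : ∀ m, m₀ ≤ m → η m = 2 / (L + μ * (2 * α m - 1)))
    (hiter : ∀ m, m₀ ≤ m → x (m + 1) = x m - η m •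
      Matrix.toEuclideanLin
        (α m • R m + ((1 - α m) * s) • (1 : Matrix (Fin n) (Fin n) ℝ))
        (gradient E (x m)))
    (hinit : ‖x m₀ - xstar‖ < min δ (2 * μ * ε / (3 * M))) :
    (∀ m, m₀ ≤ m → ‖x (m + 1) - xstar‖ ≤ ‖x m - xstar‖) ∧
    (∀ m, m₀ ≤ m → ‖x m - xstar‖ ≤
      ((L / μ + ε) / (L / μ + 3 * ε)) ^ (m - m₀) * ‖x m₀ - xstar‖ /
        (1 - (3 * M / (2 * μ * ε)) * ‖x m₀ - xstar‖)) := by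
  have hr0δ : ‖x m₀ - xstar‖ < δ := hinit.trans_le (min_le_left _ _)
  have hr0c : ‖x m₀ - xstar‖ < 2 * μ * ε / (3 * M) := hinit.trans_le (min_le_right _ _)
  have hL0 : 0 < L := by linarith
  have hinner : ∀ (A : Matrix (Fin n) (Fin n) ℝ) (v : EuclideanSpace ℝ (Fin n)),
      inner ℝ v (toEuclideanLin A v) = v.ofLp ⬝ᵥ (A *ᵥ v.ofLp) := fun A v => by
    rw [EuclideanSpace.inner_eq_star_dotProduct]
    simp [dotProduct_comm]
  have hself : ∀ v : EuclideanSpace ℝ (Fin n), v.ofLp ⬝ᵥ v.ofLp = ‖v‖ ^ 2 := fun v => by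
    rw [← real_inner_self_eq_norm_sq, EuclideanSpace.inner_eq_star_dotProduct]
    simp
  have hmul : ∀ (A B : Matrix (Fin n) (Fin n) ℝ) (v : EuclideanSpace ℝ (Fin n)),
      toEuclideanLin (A * B) v = toEuclideanLin A (toEuclideanLin B v) := fun A B v => by
    simp [toEuclideanLin_apply, Matrix.mulVec_mulVec]
  have hsym : ∀ A : Matrix (Fin n) (Fin n) ℝ, A.IsSymm → (toEuclideanLin A).IsSymmetric :=
    fun A hA => isSymmetric_toEuclideanLin_iff.mpr (by
      rw [Matrix.IsHermitian, conjTranspose_eq_transpose_of_trivial]; exact hA)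
  have hstep : ∀ m, m₀ ≤ m → ‖x m - xstar‖ < δ → 3 * M * ‖x m - xstar‖ ≤ 2 * μ * ε →
      ‖x (m + 1) - xstar‖ * (L + μ * ε) ≤
        (L - μ * ε + 3 * M * ‖x m - xstar‖) * ‖x m - xstar‖ := by
    intro m hm hmδ hmc
    obtain ⟨ha1, ha2⟩ := hα m hm
    set r := ‖x m - xstar‖ with hr
    have hr0 : 0 ≤ r := norm_nonneg _
    have hxm : x m ∈ Metric.ball xstar δ := by rwa [mem_ball_iff_norm]
    have hxs : xstar ∈ Metric.ball xstar δ := Metric.mem_ball_self hδ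
    have htay := aux_taylor (fun z => gradient E z)
      (fun y => LinearMap.toContinuousLinearMap (toEuclideanLin (G y))) hHess (x m) xstar M (by
        intro t ht
        have hmem : x m + t • (xstar - x m) ∈ Metric.ball xstar δ :=
          (convex_ball xstar δ).add_smul_sub_mem hxm hxs ht
        have := hLip _ hmem _ hxm
        rw [map_sub, map_sub] at this
        simpa using this)
    have hw : ‖gradient E (x m) - toEuclideanLin (G (x m)) (x m - xstar)‖ ≤ M / 2 * r ^ 2 := by
      rw [norm_sub_rev xstar, ← hr] at htay
      simp only [hcrit] at htay
      have he : gradient E (x m) - toEuclideanLin (G (x m)) (x m - xstar) =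
          -(0 - gradient E (x m) -
            (LinearMap.toContinuousLinearMap (toEuclideanLin (G (x m)))) (xstar - x m)) := by
        rw [← neg_sub (x m) xstar, map_neg, LinearMap.coe_toContinuousLinearMap']
        abel
      rw [he, norm_neg]
      exact htay
    have hpos := hRG m hm
    have hcomp : toEuclideanLin (R m) ∘ₗ toEuclideanLin (G (x m))
        = toEuclideanLin (R m * G (x m)) := LinearMap.ext fun v => (hmul _ _ v).symm
    have key := aux_contract (toEuclideanLin (G (x m))) (toEuclideanLin (R m))
      (toEuclideanLin (G xstar)) (toEuclideanLin absG) (hsym _ (hGsymm _)) (hsym _ (hRsymm m hm))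
      (hsym _ (hGsymm _)) (isSymmetric_toEuclideanLin_iff.mpr habs.isHermitian)
      (fun v => by rw [← hmul, ← hmul, habs2])
      (fun v => by rw [← hmul, hR2 m hm]; simp [toEuclideanLin_apply])
      (by rw [hcomp]; exact isSymmetric_toEuclideanLin_iff.mpr hpos.1.isHermitian)
      (fun v => by
        rw [← hmul, hinner]
        simpa using hpos.1.dotProduct_mulVec_nonneg v.ofLp)
      μ L (M * r) (α m) s (M / 2 * r ^ 2) hμ hμL
      (fun v => by rw [hinner, ← hself]; exact hbound v.ofLp)
      (by positivity) (by nlinarith)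
      (fun v => by
        have h1 := hLip _ hxm _ hxs
        have h2 := ContinuousLinearMap.le_of_opNorm_le _ h1 v
        simpa using h2)
      (by linarith) ha2 hs (x m - xstar) (gradient E (x m)) hw
    have hx : x (m + 1) - xstar = x m - xstar - (2 / (L + μ * (2 * α m - 1))) •
        (α m • toEuclideanLin (R m) (gradient E (x m))
          + ((1 - α m) * s) • gradient E (x m)) := by
      rw [hiter m hm, hη m hm, sub_right_comm]
      congr 2
      rw [map_add, map_smul, map_smul]
      simp [toEuclideanLin_apply]
    rw [hx]
    have hD : 0 < L + μ * (2 * α m - 1) := by nlinarith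
    have hD2 : 0 < L + μ * ε := by positivity
    refine (mul_le_mul_of_nonneg_right key hD2.le).trans ?_
    rw [← hr, div_mul_eq_mul_div, div_le_iff₀ hD]
    have hμa : μ * ε ≤ μ * (2 * α m - 1) := mul_le_mul_of_nonneg_left (by linarith) hμ.le
    generalize μ * (2 * α m - 1) = A at *
    have hident : (L - μ * ε + 3 * M * r) * r * (L + A)
        - ((L - A + 2 * (M * r)) * r + 2 * (M / 2 * r ^ 2)) * (L + μ * ε)
        = r * ((A - μ * ε) * (2 * L + 3 * M * r)) := by ring
    have : 0 ≤ r * ((A - μ * ε) * (2 * L + 3 * M * r)) :=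
      mul_nonneg hr0 (mul_nonneg (by linarith) (by positivity))
    linarith
  have hr0c' : 3 * M * ‖x m₀ - xstar‖ < 2 * μ * ε := by
    rw [lt_div_iff₀ (by positivity)] at hr0c
    linarith
  have hD2 : 0 < L + μ * ε := by positivity
  have hdec1 : ∀ m, m₀ ≤ m → ‖x m - xstar‖ ≤ ‖x m₀ - xstar‖ →
      ‖x (m + 1) - xstar‖ ≤ ‖x m - xstar‖ := by
    intro m hm hle
    have h3 : 3 * M * ‖x m - xstar‖ ≤ 2 * μ * ε :=
      (mul_le_mul_of_nonneg_left hle (by positivity)).trans hr0c'.le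
    have h1 := hstep m hm (hle.trans_lt hr0δ) h3
    have h2 := norm_nonneg (x m - xstar)
    have h4 : (L - μ * ε + 3 * M * ‖x m - xstar‖) * ‖x m - xstar‖
      ≤ (L + μ * ε) * ‖x m - xstar‖ := mul_le_mul_of_nonneg_right (by linarith) h2
    refine le_of_mul_le_mul_right (h1.trans (h4.trans_eq (mul_comm _ _))) hD2
  have hle : ∀ m, m₀ ≤ m → ‖x m - xstar‖ ≤ ‖x m₀ - xstar‖ := by
    intro m hm
    induction m, hm using Nat.le_induction with
    | base => exact le_rfl
    | succ k hk ih => exact (hdec1 k hk ih).trans ih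
  refine ⟨fun m hm => hdec1 m hm (hle m hm), ?_⟩
  set c := 3 * M / (2 * μ * ε) with hc
  have hc0 : 0 < c := by positivity
  have hcr : ∀ m, m₀ ≤ m → c * ‖x m - xstar‖ < 1 := by
    intro m hm
    have := mul_le_mul_of_nonneg_left (hle m hm) (by positivity : 0 ≤ 3 * M)
    rw [hc, div_mul_eq_mul_div, div_lt_one (by positivity)]
    linarith
  have hρ : (L / μ + ε) / (L / μ + 3 * ε) = (L + μ * ε) / (L + 3 * (μ * ε)) := by
    field_simp
  rw [hρ]
  set ρ := (L + μ * ε) / (L + 3 * (μ * ε)) with hρd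
  have hρ0 : 0 < ρ := by positivity
  have hrat : ∀ m, m₀ ≤ m → ‖x m - xstar‖ / (1 - c * ‖x m - xstar‖) ≤
      ρ ^ (m - m₀) * (‖x m₀ - xstar‖ / (1 - c * ‖x m₀ - xstar‖)) := by
    intro m hm
    induction m, hm using Nat.le_induction with
    | base => simp
    | succ k hk ih =>
      have hone : ‖x (k + 1) - xstar‖ / (1 - c * ‖x (k + 1) - xstar‖) ≤
          ρ * (‖x k - xstar‖ / (1 - c * ‖x k - xstar‖)) := by
        have h1 := hcr k hk
        have h2 := hcr (k + 1) (by omega)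
        have h3 := hstep k hk ((hle k hk).trans_lt hr0δ)
          ((mul_le_mul_of_nonneg_left (hle k hk) (by positivity)).trans hr0c'.le)
        have hM' : 3 * M = c * (2 * μ * ε) := by rw [hc]; field_simp
        rw [hM'] at h3
        have hu := norm_nonneg (x k - xstar)
        have hu' := norm_nonneg (x (k + 1) - xstar)
        generalize ‖x k - xstar‖ = u at *
        generalize ‖x (k + 1) - xstar‖ = u' at *
        have hq : 0 < μ * ε := by positivity
        rw [hρd, div_mul_div_comm, div_le_div_iff₀ (by linarith) (mul_pos (by positivity) (by linarith))]
        generalize hqq : μ * ε = q at *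
        have h3' : u' * (L + q) ≤ (L + q - 2 * q * (1 - c * u)) * u := by
          have : c * (2 * μ * ε) = 2 * c * q := by rw [← hqq]; ring
          rw [this] at h3
          linarith
        -- the recursion
        have hw : 0 < 1 - c * u := by linarith
        have h4 : u' * (L + q) * (L + q + 2 * q * (1 - c * u)) ≤ u * (L + q) * (L + q) := by
          have h5 := mul_le_mul_of_nonneg_right h3'
            (by positivity : 0 ≤ L + q + 2 * q * (1 - c * u))
          have h6 : 0 ≤ u * (2 * q * (1 - c * u)) ^ 2 := by positivity
          nlinarith
        have h7 : u' * (L + q + 2 * q * (1 - c * u)) ≤ u * (L + q) := by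
          refine le_of_mul_le_mul_right ?_ hD2
          linarith
        linarith
      refine hone.trans ?_
      rw [Nat.succ_sub hk, pow_succ]
      calc _ ≤ ρ * _ := mul_le_mul_of_nonneg_left ih hρ0.le
        _ = _ := by ring
  intro m hm
  rw [mul_div_assoc]
  refine le_trans ?_ (hrat m hm)
  have h1 := hcr m hm
  rw [le_div_iff₀ (by linarith)]
  have := norm_nonneg (x m - xstar)
  have : 0 ≤ c * ‖x m - xstar‖ := by positivity
  nlinarith
end
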